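/- arXiv:1112.2353 — 5 statements merged into one kernel-verified Lean document; each statement's English description precedes it below -/
import Mathlib

section
/- Let (R, m, k) be a commutative Noetherian local ring and M a finitely generated R-module. Assume x_1, …, x_n is a sequence of exact zero-divisors on both R and M with the same twins y_1, …, y_n respectively. Set R̄ = R/(x_1, …, x_n) and M̄ = M/(x_1, …, x_n)M. Then pd_R(M) = pd_{R̄}(M̄) and id_R(M) = id_{R̄}(M̄). -/
/-- `(x, y)` is a pair of exact zero-divisors on the `R`-module `M`:
`M ≠ xM`, `x ∉ (0 :_R M)`, `(0 :_M x) = yM` and `(0 :_M y) = xM`. -/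
def IsEZDPair (R : Type*) [CommRing R] (M : Type*) [AddCommGroup M] [Module R M]
    (x y : R) : Prop :=
  Ideal.span {x} • (⊤ : Submodule R M) ≠ ⊤ ∧
  (∃ m : M, x • m ≠ 0) ∧
  Submodule.torsionBy R M x = Ideal.span {y} • (⊤ : Submodule R M) ∧
  Submodule.torsionBy R M y = Ideal.span {x} • (⊤ : Submodule R M)

/-- `x 0, …, x (n-1)` is a sequence of exact zero-divisors on `M` with twins
`y 0, …, y (n-1)`: each `(x i, y i)` is a pair of exact zero-divisors on
`M ⧸ (x 0, …, x (i-1))M`. -/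
def IsEZDSeqWithTwins (R : Type*) [CommRing R] (M : Type*) [AddCommGroup M] [Module R M]
    {n : ℕ} (x y : Fin n → R) : Prop :=
  ∀ i : Fin n,
    IsEZDPair R (M ⧸ (Ideal.span (x '' {j | j < i}) • (⊤ : Submodule R M))) (x i) (y i)

/-- `x 0, …, x (n-1)` is a sequence of exact zero-divisors on `M`. -/
def IsEZDSeq (R : Type*) [CommRing R] (M : Type*) [AddCommGroup M] [Module R M]
    {n : ℕ} (x : Fin n → R) : Prop :=
  ∀ i : Fin n, ∃ y : R,
    IsEZDPair R (M ⧸ (Ideal.span (x '' {j | j < i}) • (⊤ : Submodule R M))) (x i) y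

universe u

open CategoryTheory in
/-- `Ext^i_R(M, N)` as an `R`-module. -/
noncomputable def extRMod (R : Type u) [CommRing R] (M N : ModuleCat.{u} R) (i : ℕ) :
    ModuleCat.{u} R :=
  ((Ext R (ModuleCat.{u} R) i).obj (Opposite.op M)).obj N

open CategoryTheory in
/-- `Tor_i^R(M, N)` as an `R`-module. -/
noncomputable def torRMod (R : Type u) [CommRing R] (M N : ModuleCat.{u} R) (i : ℕ) :
    ModuleCat.{u} R :=
  ((Tor (ModuleCat.{u} R) i).obj M).obj N

/-- The projective dimension of an `R`-module `M`, characterized via vanishing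
of `Ext^i(M, -)` for `i > d`. -/
noncomputable def projDim (R : Type u) [CommRing R] (M : ModuleCat.{u} R) : ℕ∞ :=
  sInf {d : ℕ∞ | ∀ (N : ModuleCat.{u} R) (i : ℕ), d < (i : ℕ∞) →
    Subsingleton (extRMod R M N i)}

/-- The injective dimension of an `R`-module `M`, characterized via vanishing
of `Ext^i(-, M)` for `i > d`. -/
noncomputable def injDim (R : Type u) [CommRing R] (M : ModuleCat.{u} R) : ℕ∞ :=
  sInf {d : ℕ∞ | ∀ (N : ModuleCat.{u} R) (i : ℕ), d < (i : ℕ∞) →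
    Subsingleton (extRMod R N M i)}

/-- The flat dimension of an `R`-module `M`, characterized via vanishing
of `Tor_i(-, M)` for `i > d`. -/
noncomputable def flatDim (R : Type u) [CommRing R] (M : ModuleCat.{u} R) : ℕ∞ :=
  sInf {d : ℕ∞ | ∀ (N : ModuleCat.{u} R) (i : ℕ), d < (i : ℕ∞) →
    Subsingleton (torRMod R N M i)}

open CategoryTheory Abelian

section ExtComparison

variable {R : Type u} [CommRing R]

/-- In positive degrees, the vanishing of the derived functor `Ext` is the vanishing of the
`Ext`-groups of the derived category. -/
lemma subsingleton_extRMod_succ_iff (M N : ModuleCat.{u} R) (n : ℕ) :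
    Subsingleton (extRMod R M N (n + 1)) ↔ Subsingleton (Abelian.Ext.{u} M N (n + 1)) := by
  let P := projectiveResolution M
  have key : Subsingleton (extRMod R M N (n + 1)) ↔
      ∀ f : P.complex.X (n + 1) ⟶ N, P.complex.d (n + 2) (n + 1) ≫ f = 0 →
        ∃ g : P.complex.X n ⟶ N, P.complex.d (n + 1) n ≫ g = f := by
    rw [← ModuleCat.isZero_iff_subsingleton, extRMod, (P.isoExt (n + 1) N).isZero_iff,
      ← HomologicalComplex.exactAt_iff_isZero_homology,
      HomologicalComplex.exactAt_iff' _ n (n + 1) (n + 2) (by simp) (by simp),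
      ShortComplex.moduleCat_exact_iff]
    rfl
  rw [key]
  constructor
  · intro h
    refine subsingleton_of_forall_eq 0 fun α ↦ ?_
    obtain ⟨f, hf, rfl⟩ := P.extMk_surjective α (n + 2) rfl
    exact (P.extMk_eq_zero_iff f (n + 2) rfl hf n rfl).2 (h f hf)
  · intro h f hf
    exact (P.extMk_eq_zero_iff f (n + 2) rfl hf n rfl).1 (Subsingleton.elim _ _)

lemma forall_subsingleton_extRMod_iff_hasProjectiveDimensionLT (M : ModuleCat.{u} R) (d : ℕ) :
    (∀ (N : ModuleCat.{u} R) (i : ℕ), (d : ℕ∞) < i → Subsingleton (extRMod R M N i)) ↔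
      HasProjectiveDimensionLT M (d + 1) := by
  refine ⟨fun h ↦ HasProjectiveDimensionLT.mk fun i hi Y e ↦ ?_, fun h N i hi ↦ ?_⟩
  · obtain ⟨j, rfl⟩ := Nat.exists_eq_succ_of_ne_zero (by lia : i ≠ 0)
    have := (subsingleton_extRMod_succ_iff M Y j).1 (h Y _ (by exact_mod_cast hi))
    exact Subsingleton.elim _ _
  · have hi' : d < i := by exact_mod_cast hi
    obtain ⟨j, rfl⟩ := Nat.exists_eq_succ_of_ne_zero (by lia : i ≠ 0)
    exact (subsingleton_extRMod_succ_iff M N j).2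
      (HasProjectiveDimensionLT.subsingleton M (d + 1) _ hi' N)

lemma forall_subsingleton_extRMod_iff_hasInjectiveDimensionLT (M : ModuleCat.{u} R) (d : ℕ) :
    (∀ (N : ModuleCat.{u} R) (i : ℕ), (d : ℕ∞) < i → Subsingleton (extRMod R N M i)) ↔
      HasInjectiveDimensionLT M (d + 1) := by
  refine ⟨fun h ↦ HasInjectiveDimensionLT.mk fun i hi Y e ↦ ?_, fun h N i hi ↦ ?_⟩
  · obtain ⟨j, rfl⟩ := Nat.exists_eq_succ_of_ne_zero (by lia : i ≠ 0)
    have := (subsingleton_extRMod_succ_iff Y M j).1 (h Y _ (by exact_mod_cast hi))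
    exact Subsingleton.elim _ _
  · have hi' : d < i := by exact_mod_cast hi
    obtain ⟨j, rfl⟩ := Nat.exists_eq_succ_of_ne_zero (by lia : i ≠ 0)
    exact (subsingleton_extRMod_succ_iff N M j).2
      (HasInjectiveDimensionLT.subsingleton M (d + 1) _ hi' N)

lemma projDim_congr {S : Type u} [CommRing S] (M : ModuleCat.{u} R) (N : ModuleCat.{u} S)
    (h : ∀ d : ℕ, HasProjectiveDimensionLT M (d + 1) ↔ HasProjectiveDimensionLT N (d + 1)) :
    projDim R M = projDim S N := by
  unfold projDim
  congr 1
  ext d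
  induction d using ENat.recTopCoe with
  | top => simp
  | coe d =>
    exact (forall_subsingleton_extRMod_iff_hasProjectiveDimensionLT M d).trans <|
      (h d).trans (forall_subsingleton_extRMod_iff_hasProjectiveDimensionLT N d).symm

lemma injDim_congr {S : Type u} [CommRing S] (M : ModuleCat.{u} R) (N : ModuleCat.{u} S)
    (h : ∀ d : ℕ, HasInjectiveDimensionLT M (d + 1) ↔ HasInjectiveDimensionLT N (d + 1)) :
    injDim R M = injDim S N := by
  unfold injDim
  congr 1
  ext d
  induction d using ENat.recTopCoe with
  | top => simp
  | coe d =>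
    exact (forall_subsingleton_extRMod_iff_hasInjectiveDimensionLT M d).trans <|
      (h d).trans (forall_subsingleton_extRMod_iff_hasInjectiveDimensionLT N d).symm

end ExtComparison

section DimensionShifting

variable {R : Type u} [CommRing R] {S : ShortComplex (ModuleCat.{u} R)}

lemma subsingleton_ext_X₁_iff (hS : S.ShortExact) (N : ModuleCat.{u} R) (n : ℕ)
    (h₁ : Subsingleton (Abelian.Ext.{u} S.X₂ N (n + 1)))
    (h₂ : Subsingleton (Abelian.Ext.{u} S.X₂ N (n + 2))) :
    Subsingleton (Abelian.Ext.{u} S.X₁ N (n + 1)) ↔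
      Subsingleton (Abelian.Ext.{u} S.X₃ N (n + 2)) := by
  have : IsIso (AddCommGrpCat.ofHom (hS.extClass.precomp N (add_comm 1 (n + 1)))) :=
    (Ext.contravariantSequence_exact hS N (n + 1) (n + 2)
      (add_comm 1 _)).isIso_map' 1 (by decide)
        ((AddCommGrpCat.of _).isZero_of_subsingleton.eq_zero_of_src _)
          ((AddCommGrpCat.of _).isZero_of_subsingleton.eq_zero_of_tgt _)
  exact (asIso (AddCommGrpCat.ofHom (hS.extClass.precomp N
    (add_comm 1 (n + 1))))).addCommGroupIsoToAddEquiv.subsingleton_congr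

lemma subsingleton_ext_X₃_iff (hS : S.ShortExact) (N : ModuleCat.{u} R) (n : ℕ)
    (h₁ : Subsingleton (Abelian.Ext.{u} N S.X₂ (n + 1)))
    (h₂ : Subsingleton (Abelian.Ext.{u} N S.X₂ (n + 2))) :
    Subsingleton (Abelian.Ext.{u} N S.X₃ (n + 1)) ↔
      Subsingleton (Abelian.Ext.{u} N S.X₁ (n + 2)) := by
  have : IsIso (AddCommGrpCat.ofHom (hS.extClass.postcomp N (rfl : n + 1 + 1 = n + 2))) :=
    (Ext.covariantSequence_exact N hS (n + 1) (n + 2) rfl).isIso_map' 1 (by decide)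
        ((AddCommGrpCat.of _).isZero_of_subsingleton.eq_zero_of_src _)
          ((AddCommGrpCat.of _).isZero_of_subsingleton.eq_zero_of_tgt _)
  exact (asIso (AddCommGrpCat.ofHom (hS.extClass.postcomp N
    (rfl : n + 1 + 1 = n + 2)))).addCommGroupIsoToAddEquiv.subsingleton_congr

lemma subsingleton_ext_one_iff (hS : S.ShortExact) (N : ModuleCat.{u} R)
    (h : Subsingleton (Abelian.Ext.{u} S.X₂ N 1)) :
    Subsingleton (Abelian.Ext.{u} S.X₃ N 1) ↔
      ∀ f : S.X₁ →ₗ[R] N, ∃ g : S.X₂ →ₗ[R] N, g ∘ₗ S.f.hom = f := by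
  constructor
  · intro _ f
    obtain ⟨α, hα⟩ := Ext.contravariant_sequence_exact₁ hS N (Ext.mk₀ (ModuleCat.ofHom f))
      (add_zero 1) (Subsingleton.elim _ _)
    obtain ⟨g, rfl⟩ := (Ext.mk₀_bijective _ _).2 α
    rw [Ext.mk₀_comp_mk₀, (Ext.mk₀_bijective _ _).1.eq_iff] at hα
    exact ⟨g.hom, by rw [← ModuleCat.hom_comp, hα, ModuleCat.hom_ofHom]⟩
  · intro H
    refine subsingleton_of_forall_eq 0 fun α ↦ ?_
    obtain ⟨β, rfl⟩ := Ext.contravariant_sequence_exact₃ hS N α (Subsingleton.elim _ _)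
      (add_zero 1)
    obtain ⟨f, rfl⟩ := (Ext.mk₀_bijective _ _).2 β
    obtain ⟨g, hg⟩ := H f.hom
    have : f = S.f ≫ ModuleCat.ofHom g := by ext1; simp [hg]
    rw [this, ← Ext.mk₀_comp_mk₀, hS.extClass_comp_assoc]

/-- Over a commutative ring, `Ext`-vanishing against cyclic modules bounds the injective
dimension. -/
lemma hasInjectiveDimensionLT_of_forall_ideal (N : ModuleCat.{u} R) (n : ℕ)
    (h : ∀ I : Ideal R, Subsingleton (Abelian.Ext.{u} (ModuleCat.of R (R ⧸ I)) N (n + 1))) :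
    HasInjectiveDimensionLT N (n + 1) := by
  induction n generalizing N with
  | zero =>
    rw [zero_add, ← injective_iff_hasInjectiveDimensionLT_one]
    suffices Module.Injective R N from Module.injective_object_of_injective_module R N
    refine Module.Baer.injective fun I g ↦ ?_
    let S : ShortComplex (ModuleCat.{u} R) :=
      ModuleCat.shortComplexOfCompEqZero I.subtype I.mkQ
        (LinearMap.ext fun a ↦ (Submodule.Quotient.mk_eq_zero I).2 a.2)
    have hS : S.ShortExact := ModuleCat.shortComplex_shortExact S
      (LinearMap.exact_subtype_mkQ I) I.injective_subtype I.mkQ_surjective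
    obtain ⟨g', hg'⟩ := (subsingleton_ext_one_iff hS N
      (Ext.subsingleton_of_projective (ModuleCat.of R R) N 0)).1 (h I) g
    exact ⟨g', fun a ha ↦ LinearMap.congr_fun hg' ⟨a, ha⟩⟩
  | succ n ih =>
    let S := ShortComplex.mk _ _ (Limits.cokernel.condition (Injective.ι N))
    have hS : S.ShortExact :=
      { exact := ShortComplex.exact_of_g_is_cokernel _ (Limits.cokernelIsCokernel S.f) }
    have : Injective S.X₂ := inferInstanceAs (Injective (Injective.under N))
    refine (hS.hasInjectiveDimensionLT_X₃_iff n this).1 (ih _ fun I ↦ ?_)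
    exact (subsingleton_ext_X₃_iff hS _ n (Ext.subsingleton_of_injective _ _ _)
      (Ext.subsingleton_of_injective _ _ _)).2 (h I)

end DimensionShifting

section ExactPairs

variable {A : Type*} [CommRing A]

/-- The periodic complex `⋯ → N → N → N → ⋯` with maps alternating between multiplication by
`x` and multiplication by `y` is exact. -/
structure IsExactPair (N : Type*) [AddCommGroup N] [Module A N] (x y : A) : Prop where
  left (n : N) : x • n = 0 ↔ ∃ m : N, y • m = n
  right (n : N) : y • n = 0 ↔ ∃ m : N, x • m = n

/-- The linear map `π` identifies its target with the quotient of its source by `x`. -/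
structure IsReduction {N N' : Type*} [AddCommGroup N] [Module A N] [AddCommGroup N']
    [Module A N'] (x : A) (π : N →ₗ[A] N') : Prop where
  surjective : Function.Surjective π
  eq_zero_iff (n : N) : π n = 0 ↔ ∃ m : N, x • m = n

lemma IsExactPair.symm {N : Type*} [AddCommGroup N] [Module A N] {x y : A}
    (h : IsExactPair N x y) : IsExactPair N y x :=
  ⟨h.right, h.left⟩

lemma IsReduction.smul_eq_zero {N N' : Type*} [AddCommGroup N] [Module A N] [AddCommGroup N']
    [Module A N'] {x : A} {π : N →ₗ[A] N'} (h : IsReduction x π) (n : N') : x • n = 0 := by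
  obtain ⟨n, rfl⟩ := h.surjective n
  rw [← map_smul, h.eq_zero_iff]
  exact ⟨n, rfl⟩

lemma IsReduction.comp_equiv {N N' P : Type*} [AddCommGroup N] [Module A N] [AddCommGroup N']
    [Module A N'] [AddCommGroup P] [Module A P] {x : A} {π : N →ₗ[A] N'} (h : IsReduction x π)
    (e : N' ≃ₗ[A] P) : IsReduction x (e.toLinearMap ∘ₗ π) where
  surjective := e.surjective.comp h.surjective
  eq_zero_iff n := by simpa using h.eq_zero_iff n

lemma IsReduction.finsupp {N N' : Type*} [AddCommGroup N] [Module A N] [AddCommGroup N']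
    [Module A N'] {x : A} {π : N →ₗ[A] N'} (h : IsReduction x π) (ι : Type*) :
    IsReduction x (Finsupp.mapRange.linearMap π : (ι →₀ N) →ₗ[A] (ι →₀ N')) where
  surjective := Finsupp.mapRange_surjective _ (map_zero π) h.surjective
  eq_zero_iff f := by
    constructor
    · intro hf
      have hf' (i : ι) : ∃ m : N, x • m = f i :=
        (h.eq_zero_iff _).1 (by simpa using DFunLike.congr_fun hf i)
      choose g hg using hf'
      classical
      refine ⟨Finsupp.onFinset f.support (fun i ↦ if i ∈ f.support then g i else 0)
        fun i hi ↦ ?_, ?_⟩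
      · by_contra h'
        exact hi (if_neg h')
      · ext i
        by_cases hi : i ∈ f.support
        · simp only [Finsupp.smul_apply, Finsupp.onFinset_apply, if_pos hi, hg]
        · simp [Finsupp.notMem_support_iff.1 hi]
    · rintro ⟨g, rfl⟩
      ext i
      simpa using (h.eq_zero_iff (x • g i)).2 ⟨_, rfl⟩

lemma IsExactPair.finsupp {N : Type*} [AddCommGroup N] [Module A N] {x y : A}
    (h : IsExactPair N x y) (ι : Type*) : IsExactPair (ι →₀ N) x y := by
  suffices H : ∀ {x y : A}, IsExactPair N x y → ∀ f : ι →₀ N, x • f = 0 ↔ ∃ g, y • g = f from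
    ⟨H h, H h.symm⟩
  intro x y h f
  constructor
  · intro hf
    have hf' (i : ι) : ∃ m : N, y • m = f i :=
      (h.left _).1 (by simpa using DFunLike.congr_fun hf i)
    choose g hg using hf'
    classical
    refine ⟨Finsupp.onFinset f.support (fun i ↦ if i ∈ f.support then g i else 0)
      fun i hi ↦ ?_, ?_⟩
    · by_contra h'
      exact hi (if_neg h')
    · ext i
      by_cases hi : i ∈ f.support
      · simp only [Finsupp.smul_apply, Finsupp.onFinset_apply, if_pos hi, hg]
      · simp [Finsupp.notMem_support_iff.1 hi]
  · rintro ⟨g, rfl⟩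
    ext i
    simpa using (h.left (y • g i)).2 ⟨_, rfl⟩

lemma IsExactPair.ker {F N : Type*} [AddCommGroup F] [Module A F] [AddCommGroup N]
    [Module A N] {x y : A} (hF : IsExactPair F x y) (hN : IsExactPair N x y) (f : F →ₗ[A] N)
    (hf : Function.Surjective f) : IsExactPair (LinearMap.ker f) x y := by
  suffices H : ∀ {x y : A}, IsExactPair F x y → IsExactPair N x y →
      ∀ v : LinearMap.ker f, x • v = 0 ↔ ∃ w, y • w = v from ⟨H hF hN, H hF.symm hN.symm⟩
  rintro x y hF hN ⟨v, hv⟩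
  constructor
  · intro h
    obtain ⟨w, rfl⟩ := (hF.left v).1 (congr_arg Subtype.val h)
    obtain ⟨n, hn⟩ := (hN.right (f w)).1 (by simpa using hv)
    obtain ⟨u, rfl⟩ := hf n
    refine ⟨⟨w - x • u, by simp [hn]⟩, Subtype.ext ?_⟩
    simp [smul_sub, (hF.right (x • u)).2 ⟨u, rfl⟩]
  · rintro ⟨⟨w, hw⟩, h⟩
    obtain rfl : y • w = v := congr_arg Subtype.val h
    exact Subtype.ext ((hF.left (y • w)).2 ⟨w, rfl⟩)

/-- The kernel of a reduction modulo `x` is a reduction modulo `y`. -/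
lemma IsReduction.exists_smul_reduction_ker {F X : Type*} [AddCommGroup F] [Module A F]
    [AddCommGroup X] [Module A X] {x y : A} (hF : IsExactPair F x y) {p : F →ₗ[A] X}
    (hp : IsReduction x p) :
    ∃ q : F →ₗ[A] LinearMap.ker p, IsReduction y q ∧ ∀ v, (q v : F) = x • v := by
  refine ⟨(x • LinearMap.id).codRestrict _ fun v ↦ (hp.eq_zero_iff _).2 ⟨v, rfl⟩,
    ⟨?_, fun v ↦ ?_⟩, fun v ↦ rfl⟩
  · rintro ⟨v, hv⟩
    obtain ⟨w, rfl⟩ := (hp.eq_zero_iff v).1 hv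
    exact ⟨w, rfl⟩
  · rw [← hF.left]
    exact Subtype.ext_iff

/-- Reductions restrict to kernels of surjections onto modules on which the pair is exact. -/
lemma exists_isReduction_ker {F N F' N' : Type*} [AddCommGroup F] [Module A F]
    [AddCommGroup N] [Module A N] [AddCommGroup F'] [Module A F'] [AddCommGroup N']
    [Module A N'] {x y : A} (hF : IsExactPair F x y) (hN : IsExactPair N x y)
    {f : F →ₗ[A] N} (hf : Function.Surjective f) {f' : F' →ₗ[A] N'}
    {p : F →ₗ[A] F'} (hp : IsReduction x p) {π : N →ₗ[A] N'} (hπ : IsReduction x π)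
    (hc : ∀ v, π (f v) = f' (p v)) :
    ∃ q : LinearMap.ker f →ₗ[A] LinearMap.ker f', IsReduction x q := by
  refine ⟨p.restrict fun v hv ↦ ?_, ?_, ?_⟩
  · rw [LinearMap.mem_ker] at hv ⊢
    rw [← hc, hv, map_zero]
  · rintro ⟨v', hv'⟩
    obtain ⟨v, rfl⟩ := hp.surjective v'
    rw [LinearMap.mem_ker, ← hc, hπ.eq_zero_iff] at hv'
    obtain ⟨m, hm⟩ := hv'
    obtain ⟨w, rfl⟩ := hf m
    refine ⟨⟨v - x • w, by simp [hm]⟩, Subtype.ext ?_⟩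
    simp [hp.smul_eq_zero]
  · rintro ⟨v, hv⟩
    constructor
    · intro h
      obtain ⟨w, rfl⟩ := (hp.eq_zero_iff v).1 (congr_arg Subtype.val h)
      obtain ⟨m, hm⟩ := (hN.left (f w)).1 (by simpa using hv)
      obtain ⟨u, rfl⟩ := hf m
      refine ⟨⟨w - y • u, by simp [hm]⟩, Subtype.ext ?_⟩
      simp [smul_sub, (hF.left (y • u)).2 ⟨u, rfl⟩]
    · rintro ⟨⟨w, hw⟩, h⟩
      obtain rfl : x • w = v := congr_arg Subtype.val h
      exact Subtype.ext ((hp.eq_zero_iff (x • w)).2 ⟨w, rfl⟩)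

end ExactPairs

section Reduction

variable {A B : Type*} [CommRing A] [CommRing B] [Algebra A B]

lemma IsReduction.exists_factor {N N' P : Type*} [AddCommGroup N] [Module A N] [AddCommGroup N']
    [Module A N'] [AddCommGroup P] [Module A P] {x : A} {π : N →ₗ[A] N'} (h : IsReduction x π)
    (g : N →ₗ[A] P) (hg : ∀ n, x • g n = 0) : ∃ g' : N' →ₗ[A] P, ∀ n, g' (π n) = g n := by
  have hle : LinearMap.ker π ≤ LinearMap.ker g := by
    intro n hn
    obtain ⟨m, rfl⟩ := (h.eq_zero_iff n).1 hn
    simp [hg]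
  refine ⟨(LinearMap.ker π).liftQ g hle ∘ₗ (π.quotKerEquivOfSurjective h.surjective).symm,
    fun n ↦ ?_⟩
  have : (π.quotKerEquivOfSurjective h.surjective).symm (π n) = Submodule.Quotient.mk n := by
    rw [LinearEquiv.symm_apply_eq]
    simp
  simp [this]

variable {x : A} {N N' : Type*} [AddCommGroup N] [Module A N] [AddCommGroup N'] [Module A N']
  [Module B N'] [IsScalarTower A B N']

lemma map_linearCombination_eq {ι : Type*} (π : N →ₗ[A] N') (v : ι → N) (c : ι →₀ A) :
    π (Finsupp.linearCombination A v c) = Finsupp.linearCombination B (fun i ↦ π (v i))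
      (Finsupp.mapRange.linearMap (Algebra.linearMap A B) c) := by
  induction c using Finsupp.induction_linear with
  | zero => simp
  | add c d hc hd => rw [map_add, map_add, map_add, map_add, hc, hd]
  | single i a => simp

lemma IsReduction.projective (hB : IsReduction x (Algebra.linearMap A B)) {π : N →ₗ[A] N'}
    (hπ : IsReduction x π) [Module.Projective A N] : Module.Projective B N' := by
  obtain ⟨s, hs⟩ := Module.projective_def.1 ‹Module.Projective A N›
  obtain ⟨s', hs'⟩ := hπ.exists_factor
    (Finsupp.mapRange.linearMap (Algebra.linearMap A B) ∘ₗ s)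
    (fun n ↦ (hB.finsupp N).smul_eq_zero _)
  have hsurj : Function.Surjective (algebraMap A B) := hB.surjective
  refine Module.Projective.of_split (M := N →₀ B)
    (s'.extendScalarsOfSurjective hsurj) (Finsupp.linearCombination B π) ?_
  ext n'
  obtain ⟨n, rfl⟩ := hπ.surjective n'
  calc Finsupp.linearCombination B π (s' (π n))
      = π (Finsupp.linearCombination A id (s n)) := by
        rw [hs', map_linearCombination_eq (B := B)]
        rfl
    _ = π n := congr_arg π (hs n)

lemma IsReduction.subsingleton [IsLocalRing A] [Module.Finite A N] {π : N →ₗ[A] N'}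
    (hπ : IsReduction x π) (hx : x ∈ IsLocalRing.maximalIdeal A) [Subsingleton N'] :
    Subsingleton N := by
  rw [← Submodule.subsingleton_iff A, ← subsingleton_iff_bot_eq_top, eq_comm]
  refine Submodule.eq_bot_of_le_smul_of_le_jacobson_bot (IsLocalRing.maximalIdeal A) ⊤
    Module.Finite.fg_top ?_ (IsLocalRing.maximalIdeal_le_jacobson _)
  rintro n -
  obtain ⟨m, rfl⟩ := (hπ.eq_zero_iff n).1 (Subsingleton.elim _ _)
  exact Submodule.smul_mem_smul hx trivial

/-- A family whose reduction spans already spans. -/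
lemma IsReduction.surjective_linearCombination [IsLocalRing A] [Module.Finite A N]
    (hB : IsReduction x (Algebra.linearMap A B)) {π : N →ₗ[A] N'}
    (hπ : IsReduction x π) (hx : x ∈ IsLocalRing.maximalIdeal A) {ι : Type*} (v : ι → N)
    (hv : Function.Surjective (Finsupp.linearCombination B fun i ↦ π (v i))) :
    Function.Surjective (Finsupp.linearCombination A v) := by
  rw [← LinearMap.range_eq_top, eq_top_iff]
  refine Submodule.le_of_le_smul_of_le_jacobson_bot (I := IsLocalRing.maximalIdeal A)
    Module.Finite.fg_top (IsLocalRing.maximalIdeal_le_jacobson _) ?_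
  rintro n -
  obtain ⟨c', hc'⟩ := hv (π n)
  obtain ⟨c, rfl⟩ := (hB.finsupp ι).surjective c'
  rw [← map_linearCombination_eq, ← sub_eq_zero, ← map_sub, hπ.eq_zero_iff] at hc'
  obtain ⟨m, hm⟩ := hc'
  rw [← sub_sub_cancel (Finsupp.linearCombination A v c) n, ← hm]
  exact Submodule.sub_mem_sup ⟨c, rfl⟩ (Submodule.smul_mem_smul hx trivial)

lemma IsReduction.projective_of_projective [IsNoetherianRing A] [IsLocalRing A] [IsLocalRing B]
    [Module.Finite A N] {y : A} (hA : IsExactPair A x y) (hN : IsExactPair N x y)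
    (hB : IsReduction x (Algebra.linearMap A B)) {π : N →ₗ[A] N'}
    (hπ : IsReduction x π) (hx : x ∈ IsLocalRing.maximalIdeal A) [Module.Projective B N'] :
    Module.Projective A N := by
  have : Module.Finite A N' := Module.Finite.of_surjective π hπ.surjective
  have : Module.Finite B N' := Module.Finite.of_restrictScalars_finite A B N'
  have : Module.Free B N' := Module.free_of_flat_of_isLocalRing
  let b := Module.finBasis B N'
  choose v hv using fun i ↦ hπ.surjective (b i)
  have hb : Finsupp.linearCombination B (fun i ↦ π (v i)) = b.repr.symm.toLinearMap := by
    ext i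
    simp [hv]
  let f := Finsupp.linearCombination A v
  have hf : Function.Surjective f := by
    refine hB.surjective_linearCombination hπ hx v ?_
    rw [hb]
    exact b.repr.symm.surjective
  obtain ⟨q, hq⟩ := exists_isReduction_ker (hA.finsupp _) hN hf (hB.finsupp _) hπ
    (f' := b.repr.symm.toLinearMap.restrictScalars A) fun c ↦ by
      rw [map_linearCombination_eq (B := B), hb]
      rfl
  have : Subsingleton (LinearMap.ker (b.repr.symm.toLinearMap.restrictScalars A)) := by
    rw [LinearMap.ker_eq_bot (f := b.repr.symm.toLinearMap.restrictScalars A) |>.2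
      b.repr.symm.injective]
    infer_instance
  have hs : Subsingleton (LinearMap.ker f) := hq.subsingleton hx
  have hinj : Function.Injective f := by
    rw [← LinearMap.ker_eq_bot]
    exact Submodule.subsingleton_iff_eq_bot.1 hs
  exact Module.Projective.of_equiv (LinearEquiv.ofBijective f ⟨hinj, hf⟩)

end Reduction

section ProjectiveDimension

variable {A B : Type u} [CommRing A] [CommRing B] [Algebra A B] [IsNoetherianRing A]
  [IsLocalRing A] [IsLocalRing B] {x y : A}

/-- Projective dimension is unchanged by reduction modulo an exact zero-divisor. -/
lemma IsReduction.hasProjectiveDimensionLT_iff (hA : IsExactPair A x y)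
    (hB : IsReduction x (Algebra.linearMap A B)) (hx : x ∈ IsLocalRing.maximalIdeal A) (d : ℕ)
    {N N' : Type u} [AddCommGroup N] [Module A N] [AddCommGroup N'] [Module A N'] [Module B N']
    [IsScalarTower A B N'] [Module.Finite A N] (hN : IsExactPair N x y) {π : N →ₗ[A] N'}
    (hπ : IsReduction x π) :
    HasProjectiveDimensionLT (ModuleCat.of A N) (d + 1) ↔
      HasProjectiveDimensionLT (ModuleCat.of B N') (d + 1) := by
  induction d generalizing N N' with
  | zero =>
    rw [zero_add, ← projective_iff_hasProjectiveDimensionLT_one,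
      ← projective_iff_hasProjectiveDimensionLT_one, ← IsProjective.iff_projective,
      ← IsProjective.iff_projective]
    exact ⟨fun _ ↦ hB.projective hπ, fun _ ↦ hB.projective_of_projective hA hN hπ hx⟩
  | succ d ih =>
    obtain ⟨k, v, hv⟩ := Module.Finite.exists_fin (R := A) (M := N)
    let f := Finsupp.linearCombination A v
    let f' := Finsupp.linearCombination B fun i ↦ π (v i)
    have hc (c) : π (f c) = f' (Finsupp.mapRange.linearMap (Algebra.linearMap A B) c) :=
      map_linearCombination_eq π v c
    have hf : Function.Surjective f := by
      rw [← LinearMap.range_eq_top, Finsupp.range_linearCombination, hv]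
    have hf' : Function.Surjective f' := by
      intro n'
      obtain ⟨n, rfl⟩ := hπ.surjective n'
      obtain ⟨c, rfl⟩ := hf n
      exact ⟨_, (hc c).symm⟩
    obtain ⟨q, hq⟩ := exists_isReduction_ker (hA.finsupp _) hN hf (hB.finsupp _) hπ
      (f' := f'.restrictScalars A) hc
    have hS := LinearMap.shortExact_shortComplexKer hf
    have hS' := LinearMap.shortExact_shortComplexKer hf'
    let e : LinearMap.ker (f'.restrictScalars A) ≃ₗ[A] LinearMap.ker f' :=
      { toFun v := ⟨v.1, v.2⟩
        invFun v := ⟨v.1, v.2⟩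
        map_add' _ _ := rfl
        map_smul' _ _ := rfl }
    have hP : Projective (ModuleCat.of A (Fin k →₀ A)) := inferInstance
    have hP' : Projective (ModuleCat.of B (Fin k →₀ B)) := inferInstance
    refine (hS.hasProjectiveDimensionLT_X₃_iff d hP).trans <|
      Iff.trans ?_ (hS'.hasProjectiveDimensionLT_X₃_iff d hP').symm
    exact ih ((hA.finsupp _).ker hN f hf) (hq.comp_equiv e)

end ProjectiveDimension

section InjectiveDimension

variable {A B : Type u} [CommRing A] [CommRing B] [Algebra A B]
  {N N' : Type u} [AddCommGroup N] [Module A N] [AddCommGroup N'] [Module A N'] [Module B N']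
  [IsScalarTower A B N'] {x y : A}

/-- The free modules over the quotient of `A` by `x` are acyclic for `Hom(-, N)` when `x` is an
exact zero-divisor on both `A` and `N`. -/
lemma IsReduction.subsingleton_ext_of_finsupp (i : ℕ) (hA : IsExactPair A x y)
    (hN : IsExactPair N x y) {X ι : Type u} [AddCommGroup X] [Module A X]
    {p : (ι →₀ A) →ₗ[A] X} (hp : IsReduction x p) :
    Subsingleton (Abelian.Ext.{u} (ModuleCat.of A X) (ModuleCat.of A N) (i + 1)) := by
  let S := p.shortComplexKer
  have hS : S.ShortExact := LinearMap.shortExact_shortComplexKer hp.surjective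
  have hP : Projective (ModuleCat.of A (ι →₀ A)) := inferInstance
  have hproj (m : ℕ) : Subsingleton (Abelian.Ext.{u} S.X₂ (ModuleCat.of A N) (m + 1)) :=
    Ext.subsingleton_of_projective (ModuleCat.of A (ι →₀ A)) _ m
  obtain ⟨q, hq, hqx⟩ := hp.exists_smul_reduction_ker (hA.finsupp ι)
  induction i generalizing x y X with
  | zero =>
    refine (subsingleton_ext_one_iff hS _ (hproj 0)).2 fun (g : LinearMap.ker p →ₗ[A] N) ↦ ?_
    have hg (a : ι) : ∃ n : N, x • n = g (q (Finsupp.single a 1)) := by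
      refine (hN.right _).1 ?_
      rw [← map_smul, hq.smul_eq_zero, map_zero]
    choose n hn using hg
    let h := Finsupp.linearCombination A n
    have key : g ∘ₗ q = x • h := by
      ext a
      simp [h, hn]
    refine ⟨h, LinearMap.ext fun k ↦ ?_⟩
    obtain ⟨w, rfl⟩ := hq.surjective k
    exact (congr_arg h (hqx w)).trans <| (map_smul h x w).trans (LinearMap.congr_fun key w).symm
  | succ i ih =>
    refine (subsingleton_ext_X₁_iff hS _ i (hproj _) (hproj _)).1 ?_
    obtain ⟨q', hq', hqy⟩ := hq.exists_smul_reduction_ker (hA.symm.finsupp ι)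
    exact ih hA.symm hN.symm hq (LinearMap.shortExact_shortComplexKer hq.surjective)
      (fun m ↦ Ext.subsingleton_of_projective (ModuleCat.of A (ι →₀ A)) _ m) q' hq' hqy

/-- Multiplication by `y` embeds the reduction of `N` modulo `x` into `N`, with image the
annihilator of `x`. -/
lemma IsReduction.exists_embedding (hN : IsExactPair N x y) {π : N →ₗ[A] N'}
    (hπ : IsReduction x π) : ∃ j : N' →ₗ[A] N, Function.Injective j ∧
      ∀ n, x • n = 0 → n ∈ LinearMap.range j := by
  obtain ⟨j, hj⟩ := hπ.exists_factor (y • LinearMap.id : N →ₗ[A] N)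
    fun n ↦ (hN.left _).2 ⟨n, rfl⟩
  refine ⟨j, (injective_iff_map_eq_zero j).2 fun n' hn' ↦ ?_, fun n hn ↦ ?_⟩
  · obtain ⟨n, rfl⟩ := hπ.surjective n'
    rw [hj] at hn'
    exact (hπ.eq_zero_iff n).2 ((hN.right n).1 hn')
  · obtain ⟨m, rfl⟩ := (hN.left n).1 hn
    exact ⟨π m, hj m⟩

lemma IsReduction.exists_factor_embedding (hB : IsReduction x (Algebra.linearMap A B))
    {j : N' →ₗ[A] N} (hj : Function.Injective j)
    (hj' : ∀ n, x • n = 0 → n ∈ LinearMap.range j) {L : Type u} [AddCommGroup L] [Module A L]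
    [Module B L] [IsScalarTower A B L] (g : L →ₗ[A] N) :
    ∃ g' : L →ₗ[B] N', ∀ l, j (g' l) = g l := by
  have hL (l : L) : x • l = 0 := by
    have h1 : x • (1 : B) = 0 := hB.smul_eq_zero 1
    rw [← one_smul B l, ← smul_assoc, h1, zero_smul]
  let g₀ : L →ₗ[A] N' := (LinearEquiv.ofInjective j hj).symm.toLinearMap ∘ₗ
    g.codRestrict _ fun l ↦ hj' _ (by rw [← map_smul, hL, map_zero])
  have hsurj : Function.Surjective (algebraMap A B) := hB.surjective
  refine ⟨g₀.extendScalarsOfSurjective hsurj, fun l ↦ ?_⟩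
  exact congr_arg Subtype.val ((LinearEquiv.ofInjective j hj).apply_symm_apply _)

lemma IsReduction.subsingleton_ext_iff (hA : IsExactPair A x y)
    (hB : IsReduction x (Algebra.linearMap A B)) (hN : IsExactPair N x y) {π : N →ₗ[A] N'}
    (hπ : IsReduction x π) (i : ℕ) (X : Type u) [AddCommGroup X] [Module A X] [Module B X]
    [IsScalarTower A B X] :
    Subsingleton (Abelian.Ext.{u} (ModuleCat.of B X) (ModuleCat.of B N') (i + 1)) ↔
      Subsingleton (Abelian.Ext.{u} (ModuleCat.of A X) (ModuleCat.of A N) (i + 1)) := by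
  let f := Finsupp.linearCombination B (id : X → X)
  have hf : Function.Surjective f := Finsupp.linearCombination_id_surjective B X
  have hSB := LinearMap.shortExact_shortComplexKer hf
  let k : LinearMap.ker f →ₗ[A] X →₀ B := (LinearMap.ker f).subtype.restrictScalars A
  let S : ShortComplex (ModuleCat.{u} A) :=
    ModuleCat.shortComplexOfCompEqZero (M := LinearMap.ker f) k (f.restrictScalars A)
      (by exact LinearMap.ext fun v : LinearMap.ker f ↦ v.2)
  have hSA : S.ShortExact := ModuleCat.shortComplex_shortExact S
    (LinearMap.exact_subtype_ker_map f) (LinearMap.ker f).injective_subtype hf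
  have hprojB (m : ℕ) : Subsingleton
      (Abelian.Ext.{u} (ModuleCat.of B (X →₀ B)) (ModuleCat.of B N') (m + 1)) :=
    Ext.subsingleton_of_projective _ _ m
  have hprojA (m : ℕ) : Subsingleton
      (Abelian.Ext.{u} (ModuleCat.of A (X →₀ B)) (ModuleCat.of A N) (m + 1)) :=
    (hB.finsupp X).subsingleton_ext_of_finsupp m hA hN
  induction i generalizing X with
  | zero =>
    obtain ⟨j, hj, hj'⟩ := hπ.exists_embedding hN
    refine (subsingleton_ext_one_iff hSB _ (hprojB 0)).trans <|
      Iff.trans ?_ (subsingleton_ext_one_iff hSA _ (hprojA 0)).symm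
    constructor
    · intro h (g : LinearMap.ker f →ₗ[A] N)
      obtain ⟨g', hg'⟩ := hB.exists_factor_embedding hj hj' (L := LinearMap.ker f) g
      obtain ⟨h', hh'⟩ := h g'
      let h'' : (X →₀ B) →ₗ[B] N' := h'
      refine ⟨j ∘ₗ h''.restrictScalars A, LinearMap.ext fun l ↦ ?_⟩
      exact (congr_arg j (LinearMap.congr_fun hh' l)).trans (hg' l)
    · intro h (g' : LinearMap.ker f →ₗ[B] N')
      obtain ⟨g, hg⟩ := h (j ∘ₗ g'.restrictScalars A)
      obtain ⟨h', hh'⟩ := hB.exists_factor_embedding (L := X →₀ B) hj hj' g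
      refine ⟨h', LinearMap.ext fun l ↦ hj ?_⟩
      exact (hh' _).trans (LinearMap.congr_fun hg l)
  | succ i ih =>
    refine (subsingleton_ext_X₁_iff hSB _ i (hprojB _) (hprojB _)).symm.trans <|
      Iff.trans ?_ (subsingleton_ext_X₁_iff hSA _ i (hprojA _) (hprojA _))
    have hf' := Finsupp.linearCombination_id_surjective B (LinearMap.ker f)
    refine ih (LinearMap.ker f) hf' (LinearMap.shortExact_shortComplexKer hf') ?_
      (fun m ↦ Ext.subsingleton_of_projective _ _ m)
      (fun m ↦ (hB.finsupp _).subsingleton_ext_of_finsupp m hA hN)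
    exact ModuleCat.shortComplex_shortExact _ (LinearMap.exact_subtype_ker_map _)
      (LinearMap.ker _).injective_subtype hf'

end InjectiveDimension
section InjectiveDimensionDescent

variable {A B : Type u} [CommRing A] [CommRing B] [Algebra A B]
  {N N' : Type u} [AddCommGroup N] [Module A N] [AddCommGroup N'] [Module A N'] [Module B N']
  [IsScalarTower A B N'] {x y : A}

/-- A module killed by `x` is a module over the quotient by `x`. -/
lemma IsReduction.exists_isScalarTower (hB : IsReduction x (Algebra.linearMap A B))
    (X : Type u) [AddCommGroup X] [Module A X] (hX : ∀ v : X, x • v = 0) :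
    ∃ _ : Module B X, IsScalarTower A B X := by
  have hsurj : Function.Surjective (algebraMap A B) := hB.surjective
  have hker : Module.IsTorsionBySet A X (RingHom.ker (algebraMap A B)) := by
    rintro v ⟨a, ha⟩
    obtain ⟨b, rfl⟩ := (hB.eq_zero_iff a).1 ha
    exact (mul_smul x b v).trans (hX _)
  let _ := hker.module
  let e := RingHom.quotientKerEquivOfSurjective hsurj
  let _ : Module B X := Module.compHom X e.symm.toRingHom
  refine ⟨inferInstance, .of_algebraMap_smul fun a v ↦ ?_⟩
  have h : e.symm (algebraMap A B a) = Ideal.Quotient.mk _ a :=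
    e.symm_apply_apply (Ideal.Quotient.mk _ a)
  change e.symm (algebraMap A B a) • v = a • v
  rw [h]
  rfl

lemma IsReduction.subsingleton_ext_of_smul_eq_zero (hA : IsExactPair A x y)
    (hB : IsReduction x (Algebra.linearMap A B)) (hN : IsExactPair N x y) {π : N →ₗ[A] N'}
    (hπ : IsReduction x π) {n : ℕ} [HasInjectiveDimensionLT (ModuleCat.of B N') (n + 1)]
    {X : Type u} [AddCommGroup X] [Module A X] (hX : ∀ v : X, x • v = 0) {i : ℕ} (hi : n ≤ i) :
    Subsingleton (Abelian.Ext.{u} (ModuleCat.of A X) (ModuleCat.of A N) (i + 1)) := by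
  obtain ⟨_, _⟩ := hB.exists_isScalarTower X hX
  exact (hB.subsingleton_ext_iff hA hN hπ i X).1
    (HasInjectiveDimensionLT.subsingleton (ModuleCat.of B N') (n + 1) (i + 1) (by lia) _)

/-- If `x` is regular on `X`, Nakayama's lemma deduces the vanishing of `Ext` for `X` from the
vanishing of `Ext` for `X` modulo `x`. -/
lemma subsingleton_ext_of_isSMulRegular [IsNoetherianRing A] [IsLocalRing A] [Module.Finite A N]
    (hx : x ∈ IsLocalRing.maximalIdeal A) (X : Type u) [AddCommGroup X] [Module A X]
    [Module.Finite A X] (hX : IsSMulRegular X x) (i : ℕ)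
    (h : Subsingleton
      (Abelian.Ext.{u} (ModuleCat.of A (QuotSMulTop x X)) (ModuleCat.of A N) (i + 1))) :
    Subsingleton (Abelian.Ext.{u} (ModuleCat.of A X) (ModuleCat.of A N) i) := by
  let M := ModuleCat.of A X
  let L := ModuleCat.of A N
  let S := M.smulShortComplex x
  have hS : S.ShortExact := IsSMulRegular.smulShortComplex_shortExact (M := M) hX
  have hmul (w : Abelian.Ext.{u} M L i) :
      (Ext.mk₀ (x • 𝟙 M)).comp w (zero_add i) = x • w := by
    rw [Ext.mk₀_smul, Ext.smul_comp, Ext.mk₀_id_comp]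
  by_contra! ntr
  have hx' : x ∈ (Module.annihilator A (Abelian.Ext.{u} M L i)).jacobson :=
    IsLocalRing.maximalIdeal_le_jacobson _ hx
  refine Submodule.top_ne_pointwise_smul_of_mem_jacobson_annihilator hx' (eq_comm.1 ?_)
  refine eq_top_iff.2 fun z _ ↦ ?_
  obtain ⟨w, hw⟩ := Ext.contravariant_sequence_exact₁ hS L z (add_comm 1 i)
    (@Subsingleton.elim _ h _ _)
  obtain rfl : x • w = z := (hmul w).symm.trans hw
  exact Submodule.smul_mem_pointwise_smul _ _ ⊤ trivial

lemma IsReduction.subsingleton_ext_of_finite [IsNoetherianRing A] [IsLocalRing A]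
    [Module.Finite A N] (hA : IsExactPair A x y) (hB : IsReduction x (Algebra.linearMap A B))
    (hx : x ∈ IsLocalRing.maximalIdeal A) (hN : IsExactPair N x y) {π : N →ₗ[A] N'}
    (hπ : IsReduction x π) {n : ℕ} [HasInjectiveDimensionLT (ModuleCat.of B N') (n + 1)]
    (X : Type u) [AddCommGroup X] [Module A X] [hX : Module.Finite A X] {i : ℕ} (hi : n ≤ i) :
    Subsingleton (Abelian.Ext.{u} (ModuleCat.of A X) (ModuleCat.of A N) (i + 1)) := by
  induction hX using IsNoetherianRing.induction_on_isQuotientEquivQuotientPrime with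
  | subsingleton X =>
    exact hB.subsingleton_ext_of_smul_eq_zero hA hN hπ (fun v ↦ Subsingleton.elim _ _) hi
  | quotient X p e =>
    by_cases hxp : x ∈ p.1
    · refine hB.subsingleton_ext_of_smul_eq_zero hA hN hπ (fun v ↦ e.injective ?_) hi
      obtain ⟨a, ha⟩ := Ideal.Quotient.mk_surjective (e v)
      rw [map_smul, map_zero, ← ha, Algebra.smul_def, Ideal.Quotient.algebraMap_eq,
        Ideal.Quotient.eq_zero_iff_mem.2 hxp, zero_mul]
    · refine subsingleton_ext_of_isSMulRegular hx X ?_ (i + 1)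
        (hB.subsingleton_ext_of_smul_eq_zero hA hN hπ (fun v ↦ ?_) (hi.trans i.le_succ))
      · refine (isSMulRegular_iff_right_eq_zero_of_smul).2 fun v hv ↦ e.injective ?_
        have := p.2
        have hev : Ideal.Quotient.mk p.1 x * e v = 0 := by
          rw [← Ideal.Quotient.algebraMap_eq, ← Algebra.smul_def, ← map_smul, hv, map_zero]
        rw [map_zero]
        exact (mul_eq_zero.1 hev).resolve_left (mt Ideal.Quotient.eq_zero_iff_mem.1 hxp)
      · exact Module.mem_annihilator.1 (QuotSMulTop.mem_annihilator X x) v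
  | exact X₁ X₂ X₃ f g hf hg hfg h₁ h₃ =>
    let S : ShortComplex (ModuleCat.{u} A) :=
      ModuleCat.shortComplexOfCompEqZero f g hfg.linearMap_comp_eq_zero
    have hS : S.ShortExact := ModuleCat.shortComplex_shortExact S hfg hf hg
    refine subsingleton_of_forall_eq 0 fun α ↦ ?_
    obtain ⟨β, rfl⟩ := Ext.contravariant_sequence_exact₂ hS _ α (Subsingleton.elim _ _)
    rw [Subsingleton.elim β 0, Ext.comp_zero]

lemma IsReduction.hasInjectiveDimensionLT_iff [IsNoetherianRing A] [IsLocalRing A]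
    [Module.Finite A N] (hA : IsExactPair A x y) (hB : IsReduction x (Algebra.linearMap A B))
    (hx : x ∈ IsLocalRing.maximalIdeal A) (n : ℕ) (hN : IsExactPair N x y) {π : N →ₗ[A] N'}
    (hπ : IsReduction x π) :
    HasInjectiveDimensionLT (ModuleCat.of A N) (n + 1) ↔
      HasInjectiveDimensionLT (ModuleCat.of B N') (n + 1) := by
  constructor
  · intro h
    refine HasInjectiveDimensionLT.mk fun i hi Y e ↦ ?_
    obtain ⟨j, rfl⟩ := Nat.exists_eq_succ_of_ne_zero (by lia : i ≠ 0)
    let _ : Module A Y := Module.compHom Y (algebraMap A B)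
    have : IsScalarTower A B Y := .of_algebraMap_smul fun a v ↦ rfl
    have := (hB.subsingleton_ext_iff hA hN hπ j Y).2
      (HasInjectiveDimensionLT.subsingleton (ModuleCat.of A N) (n + 1) (j + 1) hi _)
    exact Subsingleton.elim (α := Abelian.Ext.{u} (ModuleCat.of B Y) (ModuleCat.of B N') (j + 1))
      _ _
  · intro h
    exact hasInjectiveDimensionLT_of_forall_ideal _ n fun I ↦
      hB.subsingleton_ext_of_finite hA hx hN hπ (A ⧸ I) le_rfl

end InjectiveDimensionDescent
section Sequences

lemma IsEZDPair.isExactPair {R N : Type*} [CommRing R] [AddCommGroup N] [Module R N] {a b : R}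
    (h : IsEZDPair R N a b) : IsExactPair N a b := by
  have key (c : R) (n : N) : n ∈ Ideal.span {c} • (⊤ : Submodule R N) ↔ ∃ m, c • m = n := by
    simp [Submodule.ideal_span_singleton_smul, Submodule.mem_smul_pointwise_iff_exists]
  exact ⟨fun n ↦ by rw [← key, ← h.2.2.1, Submodule.mem_torsionBy_iff],
    fun n ↦ by rw [← key, ← h.2.2.2, Submodule.mem_torsionBy_iff]⟩

lemma isReduction_factor {R M : Type*} [CommRing R] [AddCommGroup M] [Module R M] {a : R}
    {P Q : Submodule R M} (hPQ : P ≤ Q) (h : ∀ m, m ∈ Q ↔ ∃ m', a • m' - m ∈ P) :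
    IsReduction a (Submodule.factor hPQ) where
  surjective := Submodule.factor_surjective hPQ
  eq_zero_iff n := by
    obtain ⟨m, rfl⟩ := P.mkQ_surjective n
    rw [P.mkQ_surjective.exists]
    refine (Submodule.Quotient.mk_eq_zero Q).trans ((h m).trans (exists_congr fun m' ↦ ?_))
    exact (Submodule.Quotient.eq P).symm

lemma isReduction_factor_smul_top {R M : Type*} [CommRing R] [AddCommGroup M] [Module R M] {a : R}
    {I J : Ideal R} (hJ : J = I ⊔ Ideal.span {a}) :
    ∃ h : I • (⊤ : Submodule R M) ≤ J • ⊤, IsReduction a (Submodule.factor h) := by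
  have hIJ : I ≤ J := hJ ▸ le_sup_left
  refine ⟨Submodule.smul_mono_left hIJ, isReduction_factor _ fun m ↦ ?_⟩
  rw [hJ, Submodule.sup_smul, Submodule.mem_sup']
  constructor
  · rintro ⟨⟨p, hp⟩, ⟨q, hq⟩, rfl⟩
    rw [Submodule.ideal_span_singleton_smul, Submodule.mem_smul_pointwise_iff_exists] at hq
    obtain ⟨m', -, rfl⟩ := hq
    exact ⟨m', by simpa using hp⟩
  · rintro ⟨m', hm'⟩
    refine ⟨⟨_, neg_mem hm'⟩, ⟨a • m', Submodule.smul_mem_smul (Ideal.mem_span_singleton_self a)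
      trivial⟩, by simp⟩

variable {R : Type u} [CommRing R] [IsNoetherianRing R] [IsLocalRing R]
  {M : Type u} [AddCommGroup M] [Module R M] [Module.Finite R M]

lemma hasDimensionLT_quotient_bot_iff (d : ℕ) :
    (HasProjectiveDimensionLT (ModuleCat.of R M) (d + 1) ↔ HasProjectiveDimensionLT
      (ModuleCat.of (R ⧸ (⊥ : Ideal R)) (M ⧸ (⊥ : Ideal R) • (⊤ : Submodule R M))) (d + 1)) ∧
    (HasInjectiveDimensionLT (ModuleCat.of R M) (d + 1) ↔ HasInjectiveDimensionLT
      (ModuleCat.of (R ⧸ (⊥ : Ideal R)) (M ⧸ (⊥ : Ideal R) • (⊤ : Submodule R M))) (d + 1)) := by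
  have hE (N : Type u) [AddCommGroup N] [Module R N] : IsExactPair N (0 : R) 1 :=
    ⟨fun n ↦ by simp, fun n ↦ by simp [eq_comm]⟩
  have hB : IsReduction (0 : R) (Algebra.linearMap R (R ⧸ (⊥ : Ideal R))) :=
    ⟨Ideal.Quotient.mk_surjective, fun r ↦ Ideal.Quotient.eq_zero_iff_mem.trans <| by
      simp [eq_comm]⟩
  have hπ : IsReduction (0 : R) ((⊥ : Ideal R) • (⊤ : Submodule R M)).mkQ :=
    ⟨Submodule.mkQ_surjective _, fun m ↦ (Submodule.Quotient.mk_eq_zero _).trans <| by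
      simp [eq_comm]⟩
  have : Nontrivial (R ⧸ (⊥ : Ideal R)) := Ideal.Quotient.nontrivial_iff.2 bot_ne_top
  have : IsLocalRing (R ⧸ (⊥ : Ideal R)) :=
    .of_surjective' (Ideal.Quotient.mk _) Ideal.Quotient.mk_surjective
  exact ⟨hB.hasProjectiveDimensionLT_iff (hE R) (zero_mem _) d (hE M) hπ,
    hB.hasInjectiveDimensionLT_iff (hE R) (zero_mem _) d (hE M) hπ⟩

lemma hasDimensionLT_quotient_sup_iff {I J : Ideal R} {a b : R} (hJ : J = I ⊔ Ideal.span {a})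
    (hR : IsEZDPair R (R ⧸ (I • (⊤ : Submodule R R))) a b)
    (hM : IsEZDPair R (M ⧸ (I • (⊤ : Submodule R M))) a b) (d : ℕ) :
    (HasProjectiveDimensionLT (ModuleCat.of (R ⧸ I) (M ⧸ I • (⊤ : Submodule R M))) (d + 1) ↔
      HasProjectiveDimensionLT (ModuleCat.of (R ⧸ J) (M ⧸ J • (⊤ : Submodule R M))) (d + 1)) ∧
    (HasInjectiveDimensionLT (ModuleCat.of (R ⧸ I) (M ⧸ I • (⊤ : Submodule R M))) (d + 1) ↔
      HasInjectiveDimensionLT (ModuleCat.of (R ⧸ J) (M ⧸ J • (⊤ : Submodule R M))) (d + 1)) := by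
  have hIJ : I ≤ J := hJ ▸ le_sup_left
  have haJ : a ∈ J := hJ ▸ Ideal.mem_sup_right (Ideal.mem_span_singleton_self a)
  have hIR : (I • ⊤ : Submodule R R) = I := by simp
  rw [hIR] at hR
  have ha : a ∈ IsLocalRing.maximalIdeal R := by
    rw [IsLocalRing.mem_maximalIdeal, mem_nonunits_iff, ← Ideal.span_singleton_eq_top]
    intro h
    exact hR.1 (by rw [h, Submodule.top_smul])
  have hI : I ≠ ⊤ := by
    rintro rfl
    exact hR.1 (Subsingleton.elim _ _)
  have hJtop : J ≠ ⊤ := by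
    refine ne_top_of_le_ne_top (IsLocalRing.maximalIdeal.isMaximal R).ne_top (hJ ▸ sup_le
      (IsLocalRing.le_maximalIdeal hI) ((Ideal.span_singleton_le_iff_mem _).2 ha))
  have : Nontrivial (R ⧸ I) := Ideal.Quotient.nontrivial_iff.2 hI
  have : Nontrivial (R ⧸ J) := Ideal.Quotient.nontrivial_iff.2 hJtop
  have : IsLocalRing (R ⧸ I) :=
    .of_surjective' (Ideal.Quotient.mk _) Ideal.Quotient.mk_surjective
  have : IsLocalRing (R ⧸ J) :=
    .of_surjective' (Ideal.Quotient.mk _) Ideal.Quotient.mk_surjective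
  let _ : Algebra (R ⧸ I) (R ⧸ J) := (Ideal.Quotient.factor hIJ).toAlgebra
  let _ : Module (R ⧸ I) (M ⧸ J • (⊤ : Submodule R M)) :=
    Module.compHom _ (algebraMap (R ⧸ I) (R ⧸ J))
  have : IsScalarTower (R ⧸ I) (R ⧸ J) (M ⧸ J • (⊤ : Submodule R M)) :=
    .of_algebraMap_smul fun _ _ ↦ rfl
  have : IsScalarTower R (R ⧸ I) (M ⧸ J • (⊤ : Submodule R M)) :=
    .of_algebraMap_smul fun _ _ ↦ rfl
  have : Module.Finite (R ⧸ I) (M ⧸ I • (⊤ : Submodule R M)) :=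
    Module.Finite.of_restrictScalars_finite R _ _
  let a' : R ⧸ I := Ideal.Quotient.mk I a
  let b' : R ⧸ I := Ideal.Quotient.mk I b
  have hA : IsExactPair (R ⧸ I) a' b' := ⟨hR.isExactPair.1, hR.isExactPair.2⟩
  have hN : IsExactPair (M ⧸ I • (⊤ : Submodule R M)) a' b' :=
    ⟨hM.isExactPair.1, hM.isExactPair.2⟩
  have hB : IsReduction a' (Algebra.linearMap (R ⧸ I) (R ⧸ J)) := by
    have h := isReduction_factor hIJ (a := a) fun r ↦ by
      rw [hJ, sup_comm, Ideal.mem_span_singleton_sup]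
      constructor
      · rintro ⟨c, i, hi, rfl⟩
        exact ⟨c, by simpa [mul_comm a c] using hi⟩
      · rintro ⟨c, hc⟩
        exact ⟨c, _, neg_mem hc, by simp [mul_comm a c]⟩
    exact ⟨h.1, h.2⟩
  have hmem : a' ∈ IsLocalRing.maximalIdeal (R ⧸ I) := by
    rw [IsLocalRing.mem_maximalIdeal]
    intro h
    refine not_isUnit_zero (M₀ := R ⧸ J) ?_
    have h0 : algebraMap (R ⧸ I) (R ⧸ J) a' = 0 := Ideal.Quotient.eq_zero_iff_mem.2 haJ
    exact h0 ▸ h.map (algebraMap (R ⧸ I) (R ⧸ J))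
  obtain ⟨hle, hπ₀⟩ := isReduction_factor_smul_top (M := M) hJ
  have hπ : IsReduction a' ((Submodule.factor hle).extendScalarsOfSurjective
    (S := R ⧸ I) Ideal.Quotient.mk_surjective) := ⟨hπ₀.1, hπ₀.2⟩
  exact ⟨hB.hasProjectiveDimensionLT_iff hA hmem d hN hπ,
    hB.hasInjectiveDimensionLT_iff hA hmem d hN hπ⟩

lemma IsEZDSeqWithTwins.hasDimensionLT_iff {n : ℕ} {x y : Fin n → R}
    (hR : IsEZDSeqWithTwins R R x y) (hM : IsEZDSeqWithTwins R M x y) (d k : ℕ) (hk : k ≤ n)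
    (I : Ideal R) (hI : I = Ideal.span (x '' {j | (j : ℕ) < k})) :
    (HasProjectiveDimensionLT (ModuleCat.of R M) (d + 1) ↔
      HasProjectiveDimensionLT (ModuleCat.of (R ⧸ I) (M ⧸ I • (⊤ : Submodule R M))) (d + 1)) ∧
    (HasInjectiveDimensionLT (ModuleCat.of R M) (d + 1) ↔
      HasInjectiveDimensionLT (ModuleCat.of (R ⧸ I) (M ⧸ I • (⊤ : Submodule R M))) (d + 1)) := by
  induction k generalizing I with
  | zero =>
    obtain rfl : I = ⊥ := by simp [hI]
    exact hasDimensionLT_quotient_bot_iff d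
  | succ k ih =>
    have h₁ := ih (by lia) _ rfl
    have hset : {j : Fin n | (j : ℕ) < k + 1} = insert ⟨k, hk⟩ {j : Fin n | (j : ℕ) < k} := by
      ext j
      simp [Fin.ext_iff]
      lia
    have h₂ := hasDimensionLT_quotient_sup_iff
      (I := Ideal.span (x '' {j | (j : ℕ) < k})) (J := I) (M := M)
      (by rw [hI, hset, Set.image_insert_eq, Ideal.span_insert, sup_comm])
      (hR ⟨k, hk⟩) (hM ⟨k, hk⟩) d
    exact ⟨h₁.1.trans h₂.1, h₁.2.trans h₂.2⟩

end Sequences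

/-- Let `M` be a finitely generated module over a Noetherian local ring `R` and let
`x 0, …, x (n-1)` be a sequence of exact zero-divisors on both `R` and `M` with the
same twins.  With `R̄ = R/(x 0, …, x (n-1))` and `M̄ = M/(x 0, …, x (n-1))M`, we have
`pd_R M = pd_R̄ M̄` and `id_R M = id_R̄ M̄`. -/
theorem projDim_injDim_eq_of_isEZDSeq
    (R : Type u) [CommRing R] [IsNoetherianRing R] [IsLocalRing R]
    (M : Type u) [AddCommGroup M] [Module R M] [Module.Finite R M]
    {n : ℕ} (x y : Fin n → R)
    (hR : IsEZDSeqWithTwins R R x y) (hM : IsEZDSeqWithTwins R M x y) :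
    projDim R (ModuleCat.of R M) =
      projDim (R ⧸ Ideal.span (Set.range x))
        (ModuleCat.of _ (M ⧸ (Ideal.span (Set.range x) • (⊤ : Submodule R M)))) ∧
    injDim R (ModuleCat.of R M) =
      injDim (R ⧸ Ideal.span (Set.range x))
        (ModuleCat.of _ (M ⧸ (Ideal.span (Set.range x) • (⊤ : Submodule R M)))) := by
  have h (d : ℕ) := hR.hasDimensionLT_iff hM d n le_rfl (Ideal.span (Set.range x)) (by simp)
  exact ⟨projDim_congr _ _ fun d ↦ (h d).1, injDim_congr _ _ fun d ↦ (h d).2⟩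
end

section
/- Let R be a commutative Noetherian ring, (x, y) a pair of exact zero-divisors on R, and 0 → M_1 → M_2 → M_3 → 0 an exact sequence of R-modules such that M_j ≠ xM_j and x ∉ (0 :_R M_j) for j = 1, 2, 3. If (x, y) is a pair of exact zero-divisors on two of the three modules M_1, M_2, M_3, then it is a pair of exact zero-divisors on the third. Moreover, in that case the induced sequence 0 → M_1/xM_1 → M_2/xM_2 → M_3/xM_3 → 0 of R/(x)-modules is exact. -/
universe u

theorem Ideal.mem_span_singleton_smul_top {R M : Type*} [CommRing R] [AddCommGroup M]
    [Module R M] {a : R} {m : M} :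
    m ∈ Ideal.span {a} • (⊤ : Submodule R M) ↔ ∃ n : M, m = a • n := by
  rw [Submodule.ideal_span_singleton_smul, Submodule.mem_smul_pointwise_iff_exists]
  simp [eq_comm]

theorem mul_eq_zero_of_isEZDPair {R : Type*} [CommRing R] {x y : R}
    (hxy : IsEZDPair R R x y) : x * y = 0 := by
  have hy : y ∈ Submodule.torsionBy R R x := by
    rw [hxy.2.2.1, Ideal.mem_span_singleton_smul_top]
    exact ⟨1, by simp⟩
  simpa using hy

theorem isEZDPair_iff_of_mul_eq_zero {R M : Type*} [CommRing R] [AddCommGroup M] [Module R M]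
    {x y : R} (hxy : x * y = 0)
    (hM : Ideal.span {x} • (⊤ : Submodule R M) ≠ ⊤ ∧ ∃ m : M, x • m ≠ 0) :
    IsEZDPair R M x y ↔
      (∀ m : M, x • m = 0 → ∃ n : M, m = y • n) ∧
      (∀ m : M, y • m = 0 → ∃ n : M, m = x • n) := by
  have key (a b : R) (hab : a * b = 0) :
      Submodule.torsionBy R M a = Ideal.span {b} • (⊤ : Submodule R M) ↔
        ∀ m : M, a • m = 0 → ∃ n : M, m = b • n := by
    simp only [SetLike.ext_iff, Submodule.mem_torsionBy_iff, Ideal.mem_span_singleton_smul_top]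
    refine ⟨fun H m => (H m).1, fun H m => ⟨H m, ?_⟩⟩
    rintro ⟨n, rfl⟩
    rw [smul_smul, hab, zero_smul]
  rw [IsEZDPair, key x y hxy, key y x (mul_comm x y ▸ hxy)]
  exact ⟨fun H => H.2.2, fun H => ⟨hM.1, hM.2, H⟩⟩

section ShortExact

variable {R M₁ M₂ M₃ : Type*} [CommRing R] [AddCommGroup M₁] [Module R M₁]
  [AddCommGroup M₂] [Module R M₂] [AddCommGroup M₃] [Module R M₃]
  {g : M₁ →ₗ[R] M₂} {h : M₂ →ₗ[R] M₃}

theorem exists_eq_smul_of_map_eq_smul (hg : Function.Injective g) {x y : R} (hxy : x * y = 0)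
    (H₁ : ∀ m : M₁, y • m = 0 → ∃ n : M₁, m = x • n) {m₁ : M₁} {m₂ : M₂}
    (hm : g m₁ = x • m₂) : ∃ n : M₁, m₁ = x • n := by
  refine H₁ m₁ (hg ?_)
  rw [map_smul, hm, smul_smul, mul_comm, hxy, zero_smul, map_zero]

theorem exists_eq_smul_add_map_of_map_eq_smul (hh : Function.Surjective h)
    (hgh : Function.Exact g h) {x : R} {m₂ : M₂} {m₃ : M₃} (hm : h m₂ = x • m₃) :
    ∃ (n : M₂) (k : M₁), m₂ = x • n + g k := by
  obtain ⟨n, rfl⟩ := hh m₃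
  obtain ⟨k, hk⟩ := (hgh (m₂ - x • n)).1 (by rw [map_sub, map_smul, hm, sub_self])
  exact ⟨n, k, by rw [hk, add_sub_cancel]⟩

theorem forall_exists_eq_smul_left (hg : Function.Injective g) (hh : Function.Surjective h)
    (hgh : Function.Exact g h) {x y : R} (hxy : x * y = 0)
    (H₂ : ∀ m : M₂, x • m = 0 → ∃ n : M₂, m = y • n)
    (H₃ : ∀ m : M₃, y • m = 0 → ∃ n : M₃, m = x • n) :
    ∀ m : M₁, x • m = 0 → ∃ n : M₁, m = y • n := by
  intro m hm
  obtain ⟨m₂, hm₂⟩ := H₂ (g m) (by rw [← map_smul, hm, map_zero])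
  obtain ⟨m₃, hm₃⟩ := H₃ (h m₂) (by rw [← map_smul, ← hm₂, hgh.apply_apply_eq_zero])
  obtain ⟨n, k, rfl⟩ := exists_eq_smul_add_map_of_map_eq_smul hh hgh hm₃
  refine ⟨k, hg ?_⟩
  rw [hm₂, smul_add, smul_smul, mul_comm, hxy, zero_smul, zero_add, map_smul]

theorem forall_exists_eq_smul_middle (hg : Function.Injective g) (hh : Function.Surjective h)
    (hgh : Function.Exact g h) {x y : R} (hxy : x * y = 0)
    (H₁ : ∀ m : M₁, x • m = 0 → ∃ n : M₁, m = y • n)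
    (H₃ : ∀ m : M₃, x • m = 0 → ∃ n : M₃, m = y • n) :
    ∀ m : M₂, x • m = 0 → ∃ n : M₂, m = y • n := by
  intro m hm
  obtain ⟨m₃, hm₃⟩ := H₃ (h m) (by rw [← map_smul, hm, map_zero])
  obtain ⟨n, k, rfl⟩ := exists_eq_smul_add_map_of_map_eq_smul hh hgh hm₃
  rw [smul_add, smul_smul, hxy, zero_smul, zero_add, ← map_smul] at hm
  obtain ⟨l, rfl⟩ := H₁ k (hg (hm.trans (map_zero g).symm))
  exact ⟨n + g l, by rw [smul_add, map_smul]⟩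

theorem forall_exists_eq_smul_right (hg : Function.Injective g) (hh : Function.Surjective h)
    (hgh : Function.Exact g h) {x y : R} (hxy : x * y = 0)
    (H₁ : ∀ m : M₁, y • m = 0 → ∃ n : M₁, m = x • n)
    (H₂ : ∀ m : M₂, x • m = 0 → ∃ n : M₂, m = y • n) :
    ∀ m : M₃, x • m = 0 → ∃ n : M₃, m = y • n := by
  intro m hm
  obtain ⟨m₂, rfl⟩ := hh m
  obtain ⟨m₁, hm₁⟩ := (hgh (x • m₂)).1 (by rw [map_smul, hm])
  obtain ⟨n, rfl⟩ := exists_eq_smul_of_map_eq_smul hg hxy H₁ hm₁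
  obtain ⟨k, hk⟩ := H₂ (m₂ - g n) (by rw [smul_sub, ← hm₁, map_smul, sub_self])
  refine ⟨h k, ?_⟩
  rw [← map_smul, ← hk, map_sub, hgh.apply_apply_eq_zero, sub_zero]

end ShortExact

/-- Two-of-three for exact zero-divisors along a short exact sequence
`0 → M₁ → M₂ → M₃ → 0` with `Mⱼ ≠ xMⱼ` and `x ∉ (0 :_R Mⱼ)`: if `(x, y)` is a pair
of exact zero-divisors on two of the modules, it is one on the third, and in that
case `0 → M₁/xM₁ → M₂/xM₂ → M₃/xM₃ → 0` is exact (stated elementwise: the induced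
map on quotients is injective, exact in the middle, and surjective). -/
theorem isEZDPair_two_of_three
    (R : Type u) [CommRing R] [IsNoetherianRing R] (x y : R)
    (hxy : IsEZDPair R R x y)
    (M₁ M₂ M₃ : Type u) [AddCommGroup M₁] [Module R M₁] [AddCommGroup M₂] [Module R M₂]
    [AddCommGroup M₃] [Module R M₃]
    (g : M₁ →ₗ[R] M₂) (h : M₂ →ₗ[R] M₃)
    (hg : Function.Injective g) (hh : Function.Surjective h) (hgh : Function.Exact g h)
    (h1 : Ideal.span {x} • (⊤ : Submodule R M₁) ≠ ⊤ ∧ ∃ m : M₁, x • m ≠ 0)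
    (h2 : Ideal.span {x} • (⊤ : Submodule R M₂) ≠ ⊤ ∧ ∃ m : M₂, x • m ≠ 0)
    (h3 : Ideal.span {x} • (⊤ : Submodule R M₃) ≠ ⊤ ∧ ∃ m : M₃, x • m ≠ 0) :
    ((IsEZDPair R M₁ x y ∧ IsEZDPair R M₂ x y) ∨
     (IsEZDPair R M₁ x y ∧ IsEZDPair R M₃ x y) ∨
     (IsEZDPair R M₂ x y ∧ IsEZDPair R M₃ x y)) →
    ((IsEZDPair R M₁ x y ∧ IsEZDPair R M₂ x y ∧ IsEZDPair R M₃ x y) ∧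
     (∀ m₁ : M₁, g m₁ ∈ Ideal.span {x} • (⊤ : Submodule R M₂) →
        m₁ ∈ Ideal.span {x} • (⊤ : Submodule R M₁)) ∧
     (∀ m₂ : M₂, h m₂ ∈ Ideal.span {x} • (⊤ : Submodule R M₃) →
        ∃ m₁ : M₁, m₂ - g m₁ ∈ Ideal.span {x} • (⊤ : Submodule R M₂)) ∧
     (∀ m₃ : M₃, ∃ m₂ : M₂, m₃ - h m₂ ∈ Ideal.span {x} • (⊤ : Submodule R M₃))) := by
  have hx := mul_eq_zero_of_isEZDPair hxy
  have hy : y * x = 0 := mul_comm x y ▸ hx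
  simp only [isEZDPair_iff_of_mul_eq_zero hx h1, isEZDPair_iff_of_mul_eq_zero hx h2,
    isEZDPair_iff_of_mul_eq_zero hx h3, Ideal.mem_span_singleton_smul_top]
  intro H
  rw [and_iff_left_of_imp]
  · rcases H with ⟨⟨a, b⟩, c, d⟩ | ⟨⟨a, b⟩, c, d⟩ | ⟨⟨a, b⟩, c, d⟩
    · exact ⟨⟨a, b⟩, ⟨c, d⟩, forall_exists_eq_smul_right hg hh hgh hx b c,
        forall_exists_eq_smul_right hg hh hgh hy a d⟩
    · exact ⟨⟨a, b⟩, ⟨forall_exists_eq_smul_middle hg hh hgh hx a c,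
        forall_exists_eq_smul_middle hg hh hgh hy b d⟩, c, d⟩
    · exact ⟨⟨forall_exists_eq_smul_left hg hh hgh hx a d,
        forall_exists_eq_smul_left hg hh hgh hy b c⟩, ⟨a, b⟩, c, d⟩
  · rintro ⟨⟨-, H₁⟩, -⟩
    refine ⟨?_, ?_, ?_⟩
    · rintro m₁ ⟨m₂, hm⟩
      exact exists_eq_smul_of_map_eq_smul hg hx H₁ hm
    · rintro m₂ ⟨m₃, hm⟩
      obtain ⟨n, k, rfl⟩ := exists_eq_smul_add_map_of_map_eq_smul hh hgh hm
      exact ⟨k, n, add_sub_cancel_right _ _⟩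
    · intro m₃
      obtain ⟨m₂, rfl⟩ := hh m₃
      exact ⟨m₂, 0, by rw [sub_self, smul_zero]⟩
end

section
/- Let (R, m) be an Artinian commutative Noetherian local ring with m^{n+1} = 0 and m^n ≠ 0. Assume x_1, …, x_n is a sequence of exact zero-divisors on R with μ_R((x_1, …, x_n)) = n and with twins y_1, …, y_n respectively. Then m = (x_1, …, x_n) and y_j ∉ m^2 for all j with 1 ≤ j ≤ n. -/
/-- The minimal number of generators `μ_R(I)` of an ideal `I`. -/
noncomputable def minGens (R : Type*) [CommRing R] (I : Ideal R) : ℕ :=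
  sInf {k : ℕ | ∃ s : Finset R, s.card = k ∧ Ideal.span (s : Set R) = I}

universe u

open IsLocalRing

/-- Multiples of `x` in `R ⧸ N` are the classes of the elements of `N + (x)`. -/
lemma mk_mem_span_singleton_smul_top_iff {R : Type*} [CommRing R] (N : Submodule R R) (x r : R) :
    (Submodule.Quotient.mk r : R ⧸ N) ∈ Ideal.span {x} • (⊤ : Submodule R (R ⧸ N)) ↔
      r ∈ N ⊔ Ideal.span {x} := by
  rw [Submodule.ideal_span_singleton_smul, Submodule.mem_smul_pointwise_iff_exists]
  constructor
  · rintro ⟨m, -, hm⟩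
    obtain ⟨a, rfl⟩ := Submodule.Quotient.mk_surjective N m
    rw [← Submodule.Quotient.mk_smul, Submodule.Quotient.eq] at hm
    refine Submodule.mem_sup.2 ⟨-(x • a - r), N.neg_mem hm, x • a,
      Ideal.mem_span_singleton.2 ⟨a, rfl⟩, by ring⟩
  · intro hr
    obtain ⟨b, hb, c, hc, rfl⟩ := Submodule.mem_sup.1 hr
    obtain ⟨a, rfl⟩ := Ideal.mem_span_singleton.1 hc
    refine ⟨Submodule.Quotient.mk a, trivial, ?_⟩
    rw [← Submodule.Quotient.mk_smul, Submodule.Quotient.eq]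
    simpa using hb

namespace IsEZDPair

variable {R : Type*} [CommRing R] {N : Submodule R R} {x y : R}

lemma sup_span_ne_top (h : IsEZDPair R (R ⧸ N) x y) : N ⊔ Ideal.span {x} ≠ ⊤ := by
  refine fun htop => h.1 (eq_top_iff.2 fun m _ => ?_)
  obtain ⟨r, rfl⟩ := Submodule.Quotient.mk_surjective N m
  rw [mk_mem_span_singleton_smul_top_iff, htop]
  trivial

lemma notMem (h : IsEZDPair R (R ⧸ N) x y) : x ∉ N := by
  intro hx
  obtain ⟨m, hm⟩ := h.2.1
  obtain ⟨r, rfl⟩ := Submodule.Quotient.mk_surjective N m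
  refine hm ?_
  rw [← Submodule.Quotient.mk_smul, Submodule.Quotient.mk_eq_zero, smul_eq_mul, mul_comm]
  exact N.smul_mem r hx

lemma mul_mem_iff (h : IsEZDPair R (R ⧸ N) x y) (r : R) :
    y * r ∈ N ↔ r ∈ N ⊔ Ideal.span {x} := by
  rw [← mk_mem_span_singleton_smul_top_iff, ← h.2.2.2, Submodule.mem_torsionBy_iff,
    ← Submodule.Quotient.mk_smul, Submodule.Quotient.mk_eq_zero, smul_eq_mul]

lemma twin_mem_maximalIdeal [IsLocalRing R] (h : IsEZDPair R (R ⧸ N) x y) :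
    y ∈ maximalIdeal R := by
  rw [mem_maximalIdeal, mem_nonunits_iff]
  intro hy
  have hxy : y * x ∈ N :=
    (h.mul_mem_iff x).2 (le_sup_right (a := N) (Ideal.mem_span_singleton_self x))
  exact h.notMem ((Ideal.unit_mul_mem_iff_mem N hy).1 hxy)

end IsEZDPair

/-- The ideal generated by the first `k` terms of `x`. -/
def initialIdeal {R : Type*} [CommRing R] {n : ℕ} (x : Fin n → R) (k : ℕ) : Ideal R :=
  Ideal.span (x '' {j | (j : ℕ) < k})

section initialIdeal

variable {R : Type*} [CommRing R] {n : ℕ} (x : Fin n → R)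

lemma initialIdeal_zero : initialIdeal x 0 = ⊥ := by
  simp [initialIdeal]

lemma initialIdeal_self : initialIdeal x n = Ideal.span (Set.range x) := by
  simp [initialIdeal]

lemma initialIdeal_succ (i : Fin n) :
    initialIdeal x (i + 1) = initialIdeal x i ⊔ Ideal.span {x i} := by
  rw [initialIdeal, initialIdeal, ← Ideal.span_union, ← Set.image_singleton, ← Set.image_union]
  congr 2
  ext j
  simp only [Set.mem_ofPred_eq, Set.mem_union, Set.mem_singleton_iff, Fin.ext_iff]
  omega

end initialIdeal

namespace IsEZDSeqWithTwins

variable {R : Type*} [CommRing R] {n : ℕ} {x y : Fin n → R}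

lemma isEZDPair (h : IsEZDSeqWithTwins R R x y) (i : Fin n) :
    IsEZDPair R (R ⧸ (initialIdeal x i : Submodule R R)) (x i) (y i) := by
  have hi := h i
  have heq : Ideal.span (x '' {j | j < i}) • (⊤ : Submodule R R) = initialIdeal x i := by
    rw [smul_eq_mul, Ideal.mul_top]
    rfl
  rwa [heq] at hi

lemma mul_mem_initialIdeal_iff (h : IsEZDSeqWithTwins R R x y) (i : Fin n) (r : R) :
    y i * r ∈ initialIdeal x i ↔ r ∈ initialIdeal x (i + 1) := by
  rw [initialIdeal_succ]
  exact (h.isEZDPair i).mul_mem_iff r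

variable [IsLocalRing R]

lemma twin_mem_maximalIdeal (h : IsEZDSeqWithTwins R R x y) (i : Fin n) :
    y i ∈ maximalIdeal R :=
  (h.isEZDPair i).twin_mem_maximalIdeal

lemma span_range_ne_top (h : IsEZDSeqWithTwins R R x y) : Ideal.span (Set.range x) ≠ ⊤ := by
  rw [← initialIdeal_self]
  cases n with
  | zero => rw [initialIdeal_zero]; exact bot_ne_top
  | succ k =>
    have hk := (h.isEZDPair (Fin.last k)).sup_span_ne_top
    rwa [← initialIdeal_succ] at hk

lemma maximalIdeal_pow_le_initialIdeal (h : IsEZDSeqWithTwins R R x y)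
    (hm : maximalIdeal R ^ (n + 1) = ⊥) {k : ℕ} (hk : k ≤ n) :
    maximalIdeal R ^ (n + 1 - k) ≤ initialIdeal x k := by
  induction k with
  | zero => rw [Nat.sub_zero, hm]; exact bot_le
  | succ k ih =>
    intro r hr
    refine (h.mul_mem_initialIdeal_iff ⟨k, hk⟩ r).1 (ih (Nat.le_of_succ_le hk) ?_)
    rw [show n + 1 - k = n + 1 - (k + 1) + 1 by omega, pow_succ']
    exact Ideal.mul_mem_mul (h.twin_mem_maximalIdeal _) hr

lemma not_maximalIdeal_pow_le_initialIdeal (h : IsEZDSeqWithTwins R R x y) {k : ℕ}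
    (hk : k ≤ n) : ¬ maximalIdeal R ^ (n - k) ≤ initialIdeal x k := by
  induction hk using Nat.decreasingInduction with
  | self =>
    rw [Nat.sub_self, pow_zero, Ideal.one_eq_top, top_le_iff, initialIdeal_self]
    exact h.span_range_ne_top
  | of_succ k hk ih =>
    refine fun hle => ih fun r hr => (h.mul_mem_initialIdeal_iff ⟨k, hk⟩ r).1 (hle ?_)
    rw [show n - k = n - (k + 1) + 1 by omega, pow_succ']
    exact Ideal.mul_mem_mul (h.twin_mem_maximalIdeal _) hr

theorem span_range_eq_maximalIdeal (h : IsEZDSeqWithTwins R R x y)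
    (hm : maximalIdeal R ^ (n + 1) = ⊥) : Ideal.span (Set.range x) = maximalIdeal R := by
  refine le_antisymm (le_maximalIdeal h.span_range_ne_top) ?_
  simpa [initialIdeal_self] using h.maximalIdeal_pow_le_initialIdeal hm le_rfl

theorem twin_notMem_maximalIdeal_sq (h : IsEZDSeqWithTwins R R x y)
    (hm : maximalIdeal R ^ (n + 1) = ⊥) (j : Fin n) : y j ∉ maximalIdeal R ^ 2 := by
  refine fun hy => h.not_maximalIdeal_pow_le_initialIdeal (Nat.succ_le_of_lt j.2) fun r hr =>
    (h.mul_mem_initialIdeal_iff j r).1 (h.maximalIdeal_pow_le_initialIdeal hm j.2.le ?_)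
  rw [show n + 1 - (j : ℕ) = 2 + (n - (j + 1)) by omega, pow_add]
  exact Ideal.mul_mem_mul hy hr

end IsEZDSeqWithTwins

/-- Let `(R, 𝔪)` be an Artinian local ring with `𝔪^(n+1) = 0` and `𝔪^n ≠ 0`.  If
`x 0, …, x (n-1)` is a sequence of exact zero-divisors on `R` with
`μ_R((x 0, …, x (n-1))) = n` and twins `y 0, …, y (n-1)`, then
`𝔪 = (x 0, …, x (n-1))` and `y j ∉ 𝔪²` for all `j`. -/
theorem maximalIdeal_eq_span_of_minimal_isEZDSeq
    (R : Type u) [CommRing R] [IsNoetherianRing R] [IsLocalRing R] [IsArtinianRing R]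
    {n : ℕ} (hm1 : IsLocalRing.maximalIdeal R ^ (n + 1) = ⊥)
    (hm2 : IsLocalRing.maximalIdeal R ^ n ≠ ⊥)
    (x y : Fin n → R) (hseq : IsEZDSeqWithTwins R R x y)
    (hmin : minGens R (Ideal.span (Set.range x)) = n) :
    Ideal.span (Set.range x) = IsLocalRing.maximalIdeal R ∧
    ∀ j : Fin n, y j ∉ IsLocalRing.maximalIdeal R ^ 2 := by
  exact ⟨hseq.span_range_eq_maximalIdeal hm1, hseq.twin_notMem_maximalIdeal_sq hm1⟩
end

section
/- Let R be a commutative Noetherian local ring and x_1, …, x_n nonzero non-unit elements of R. The following are equivalent: (i) x_1, …, x_n is a strong sequence of exact zero-divisors on R; (ii) for any choice of distinct indices i_1, …, i_k in {1, …, n} and each j ∈ {1, …, n} \ {i_1, …, i_k}, x_j is an exact zero-divisor on R and Ext^i_R(R/(x_j), R/(x_{i_1}, …, x_{i_k})) = 0 for all i > 0; (iii) for any such choice of indices, x_j is an exact zero-divisor on R and Tor^R_i(R/(x_{i_1}, …, x_{i_k}), R/(x_j)) = 0 for all i > 0. -/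
/-- `x 0, …, x (n-1)` is a strong sequence of exact zero-divisors on `R` with twins
`y 0, …, y (n-1)`: it is a sequence of exact zero-divisors with these twins, and for
any choice of distinct indices `i₁, …, i_k` (encoded as a finset `s`) and any
`j ∉ s`, `(x j, y j)` is a pair of exact zero-divisors on `R/(x i₁, …, x i_k)`. -/
def IsStrongEZDSeqWithTwins (R : Type*) [CommRing R] {n : ℕ} (x y : Fin n → R) : Prop :=
  IsEZDSeqWithTwins R R x y ∧
  ∀ (s : Finset (Fin n)) (j : Fin n), j ∉ s →
    IsEZDPair R (R ⧸ (Ideal.span (x '' ↑s) • (⊤ : Submodule R R))) (x j) (y j)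

/-- `x 0, …, x (n-1)` is a strong sequence of exact zero-divisors on `R`. -/
def IsStrongEZDSeq (R : Type*) [CommRing R] {n : ℕ} (x : Fin n → R) : Prop :=
  ∃ y : Fin n → R, IsStrongEZDSeqWithTwins R x y

universe u

/-- Exactness of multiplication by `a` on `A` followed by multiplication by `b`, elementwise:
every element killed by `b` is a multiple of `a`. -/
def SMulExact (R : Type*) [CommRing R] (A : Type*) [AddCommGroup A] [Module R A] (a b : R) :
    Prop :=
  ∀ m : A, b • m = 0 → ∃ m' : A, a • m' = m

theorem LinearEquiv.smulExact_iff {R : Type*} [CommRing R] {A B : Type*} [AddCommGroup A]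
    [Module R A] [AddCommGroup B] [Module R B] (e : A ≃ₗ[R] B) {a b : R} :
    SMulExact R A a b ↔ SMulExact R B a b := by
  refine ⟨fun h m hm ↦ ?_, fun h m hm ↦ ?_⟩
  · obtain ⟨m', hm'⟩ := h (e.symm m) (by rw [← map_smul, hm, map_zero])
    exact ⟨e m', by rw [← map_smul, hm', e.apply_symm_apply]⟩
  · obtain ⟨m', hm'⟩ := h (e m) (by rw [← map_smul, hm, map_zero])
    exact ⟨e.symm m', by rw [← map_smul, hm', e.symm_apply_apply]⟩

theorem mem_ideal_span_singleton_smul_top {R : Type*} [CommRing R] {A : Type*} [AddCommGroup A]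
    [Module R A] {a : R} {m : A} :
    m ∈ Ideal.span {a} • (⊤ : Submodule R A) ↔ ∃ m' : A, a • m' = m := by
  simp [Submodule.ideal_span_singleton_smul, Submodule.mem_smul_pointwise_iff_exists]

theorem isEZDPair_iff {R : Type*} [CommRing R] {A : Type*} [AddCommGroup A] [Module R A]
    {x y : R} : IsEZDPair R A x y ↔ (∃ m : A, ∀ m' : A, x • m' ≠ m) ∧ (∃ m : A, x • m ≠ 0) ∧
      (∀ m : A, x • y • m = 0) ∧ SMulExact R A x y ∧ SMulExact R A y x := by
  simp only [IsEZDPair, Submodule.ext_iff, ne_eq, Submodule.mem_top, iff_true, not_forall,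
    Submodule.mem_torsionBy_iff, mem_ideal_span_singleton_smul_top, SMulExact, not_exists]
  refine and_congr_right fun _ ↦ and_congr_right fun _ ↦ ⟨fun ⟨h₁, h₂⟩ ↦ ?_, fun ⟨h₀, h₂, h₁⟩ ↦ ?_⟩
  · exact ⟨fun m ↦ (h₁ _).2 ⟨m, rfl⟩, fun m ↦ (h₂ m).1, fun m ↦ (h₁ m).1⟩
  · refine ⟨fun m ↦ ⟨h₁ m, ?_⟩, fun m ↦ ⟨h₂ m, ?_⟩⟩
    · rintro ⟨m', rfl⟩
      exact h₀ m'
    · rintro ⟨m', rfl⟩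
      rw [smul_comm, h₀]

theorem IsEZDPair.of_linearEquiv {R : Type*} [CommRing R] {A B : Type*} [AddCommGroup A]
    [Module R A] [AddCommGroup B] [Module R B] {x y : R} (h : IsEZDPair R A x y)
    (e : A ≃ₗ[R] B) : IsEZDPair R B x y := by
  rw [isEZDPair_iff] at h ⊢
  obtain ⟨⟨a, ha⟩, ⟨b, hb⟩, h₀, h₁, h₂⟩ := h
  refine ⟨⟨e a, fun m' hm' ↦ ha (e.symm m') ?_⟩, ⟨e b, ?_⟩, fun m ↦ ?_, e.smulExact_iff.1 h₁,
    e.smulExact_iff.1 h₂⟩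
  · rw [← map_smul, hm', e.symm_apply_apply]
  · rwa [← map_smul, e.map_ne_zero_iff]
  · apply e.symm.injective
    rw [map_smul, map_smul, h₀, map_zero]

section Resolution

open CategoryTheory

variable {R : Type u} [CommRing R]

theorem smul_id_comp_smul_id {C : Type*} [Category* C] [Preadditive C] [Linear R C] (A : C)
    {a b : R} (hab : a * b = 0) : (a • 𝟙 A) ≫ (b • 𝟙 A) = 0 := by
  rw [Linear.smul_comp, Linear.comp_smul, smul_smul, hab, zero_smul]

/-- The complex `⋯ → R → R → R → 0` with differentials alternating between multiplication by `x`
(into degree `0`) and by `y`. -/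
noncomputable abbrev periodicComplex (x y : R) (hxy : x * y = 0) :
    ChainComplex (ModuleCat.{u} R) ℕ :=
  HomologicalComplex.alternatingConst (ModuleCat.of R R) (φ := y • 𝟙 _) (ψ := x • 𝟙 _)
    (smul_id_comp_smul_id _ ((mul_comm y x).trans hxy)) (smul_id_comp_smul_id _ hxy)
    fun _ _ ↦ ComplexShape.down_nat_odd_add

/-- The augmentation of `periodicComplex x y` onto `R ⧸ (x)`. -/
noncomputable def periodicComplexπ (x y : R) (hxy : x * y = 0) :
    periodicComplex x y hxy ⟶
      (ChainComplex.single₀ (ModuleCat.{u} R)).obj (ModuleCat.of R (R ⧸ Ideal.span {x})) :=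
  ((periodicComplex x y hxy).toSingle₀Equiv _).symm
    ⟨ModuleCat.ofHom (Ideal.span {x}).mkQ, by
      ext
      change (Ideal.Quotient.mk (Ideal.span {x})) (x * 1) = 0
      rw [mul_one, Ideal.Quotient.eq_zero_iff_mem]
      exact Ideal.mem_span_singleton_self x⟩

theorem exact_smul_id_iff (A : ModuleCat.{u} R) (a b : R) (h) :
    (ShortComplex.mk (a • 𝟙 A) (b • 𝟙 A) h).Exact ↔ SMulExact R A a b := by
  rw [ShortComplex.moduleCat_exact_iff]
  rfl

theorem quasiIso_periodicComplexπ {x y : R} (hxy : x * y = 0) (hx : SMulExact R R x y)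
    (hy : SMulExact R R y x) : QuasiIso (periodicComplexπ x y hxy) where
  quasiIsoAt m := by
    induction m with
    | zero =>
      simp only [periodicComplexπ]
      rw [ChainComplex.quasiIsoAt₀_iff, ShortComplex.quasiIso_iff_of_zeros' _ rfl rfl rfl]
      constructor
      · rw [ShortComplex.moduleCat_exact_iff]
        intro m hm
        obtain ⟨c, hc⟩ := Ideal.mem_span_singleton'.1
          ((Submodule.Quotient.mk_eq_zero (Ideal.span {x})).1 hm)
        exact ⟨c, (mul_comm x c).trans hc⟩
      · rw [ModuleCat.epi_iff_surjective]
        exact Submodule.mkQ_surjective _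
    | succ m _ =>
      rw [quasiIsoAt_iff_exactAt' (hL := ChainComplex.exactAt_succ_single_obj ..),
          HomologicalComplex.exactAt_iff' _ (m + 2) (m + 1) m (by simp) (by simp)]
      rcases Nat.even_or_odd (m + 1) with hm | hm
      · rw [ShortComplex.exact_iff_of_iso (HomologicalComplex.alternatingConstScIsoEven _ _ _ _
          (by simp) (by simp) hm), exact_smul_id_iff]
        exact hx
      · rw [ShortComplex.exact_iff_of_iso (HomologicalComplex.alternatingConstScIsoOdd _ _ _ _
          (by simp) (by simp) hm), exact_smul_id_iff]
        exact hy

/-- If `(0 : x) = (y)` and `(0 : y) = (x)`, then `periodicComplex x y` is a free resolution of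
`R ⧸ (x)`. -/
noncomputable def periodicResolution {x y : R} (hxy : x * y = 0) (hx : SMulExact R R x y)
    (hy : SMulExact R R y x) : ProjectiveResolution (ModuleCat.of R (R ⧸ Ideal.span {x})) where
  complex := periodicComplex x y hxy
  projective _ := inferInstanceAs (Projective (ModuleCat.of R R))
  π := periodicComplexπ x y hxy
  quasiIso := quasiIso_periodicComplexπ hxy hx hy

theorem isZero_leftDerived_succ_iff {D : Type*} [Category* D] [Abelian D]
    (F : ModuleCat.{u} R ⥤ D) [F.Additive]
    {x y : R} (hxy : x * y = 0) (hx : SMulExact R R x y) (hy : SMulExact R R y x) :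
    (∀ i, 0 < i → Limits.IsZero ((F.leftDerived i).obj (ModuleCat.of R (R ⧸ Ideal.span {x})))) ↔
    (∀ h, (ShortComplex.mk (F.map (x • 𝟙 (ModuleCat.of R R)))
      (F.map (y • 𝟙 (ModuleCat.of R R))) h).Exact) ∧
    (∀ h, (ShortComplex.mk (F.map (y • 𝟙 (ModuleCat.of R R)))
      (F.map (x • 𝟙 (ModuleCat.of R R))) h).Exact) := by
  have key (m : ℕ) : Limits.IsZero ((F.leftDerived (m + 1)).obj
      (ModuleCat.of R (R ⧸ Ideal.span {x}))) ↔
      (((periodicComplex x y hxy).sc' (m + 2) (m + 1) m).map F).Exact := by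
    rw [((periodicResolution hxy hx hy).isoLeftDerivedObj F (m + 1)).isZero_iff]
    change Limits.IsZero (HomologicalComplex.homology _ (m + 1)) ↔ _
    rw [← HomologicalComplex.exactAt_iff_isZero_homology,
      HomologicalComplex.exactAt_iff' _ (m + 2) (m + 1) m (by simp) (by simp)]
    rfl
  have keyEven (m : ℕ) (hm : Even (m + 1)) := (key m).trans (ShortComplex.exact_iff_of_iso
    (F.mapShortComplex.mapIso (HomologicalComplex.alternatingConstScIsoEven _ _ _ _
          (by simp) (by simp) hm)))
  have keyOdd (m : ℕ) (hm : Odd (m + 1)) := (key m).trans (ShortComplex.exact_iff_of_iso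
    (F.mapShortComplex.mapIso (HomologicalComplex.alternatingConstScIsoOdd _ _ _ _
          (by simp) (by simp) hm)))
  constructor
  · intro h
    exact ⟨fun _ ↦ (keyEven 1 (by decide)).1 (h _ (by simp)),
      fun _ ↦ (keyOdd 0 (by decide)).1 (h _ (by simp))⟩
  · rintro ⟨h₁, h₂⟩ (_ | m) hm
    · simp at hm
    · rcases Nat.even_or_odd (m + 1) with hm | hm
      · exact (keyEven m hm).2 (h₁ _)
      · exact (keyOdd m hm).2 (h₂ _)

theorem subsingleton_torRMod_iff {x y : R} (hxy : x * y = 0) (hx : SMulExact R R x y)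
    (hy : SMulExact R R y x) (N : ModuleCat.{u} R) :
    (∀ i, 0 < i → Subsingleton (torRMod R N (ModuleCat.of R (R ⧸ Ideal.span {x})) i)) ↔
      SMulExact R N x y ∧ SMulExact R N y x := by
  have := isZero_leftDerived_succ_iff ((MonoidalCategory.tensoringLeft _).obj N) hxy hx hy
  simp only [ModuleCat.isZero_iff_subsingleton] at this
  refine this.trans ?_
  have h0 {a b : R} (hab : a * b = 0) :
    (∀ h, (ShortComplex.mk (((MonoidalCategory.tensoringLeft _).obj N).map
      (a • 𝟙 (ModuleCat.of R R))) (((MonoidalCategory.tensoringLeft _).obj N).map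
      (b • 𝟙 (ModuleCat.of R R))) h).Exact) ↔ SMulExact R N a b := by
    have h1 (a : R) : ((MonoidalCategory.tensoringLeft _).obj N).map
        (a • 𝟙 (ModuleCat.of R R)) = a • 𝟙 _ := by
      rw [Functor.map_smul, CategoryTheory.Functor.map_id]
    simp only [h1]
    rw [forall_prop_of_true (smul_id_comp_smul_id _ hab), exact_smul_id_iff]
    exact (TensorProduct.rid R N).smulExact_iff
  rw [h0 hxy, h0 ((mul_comm _ _).trans hxy)]

theorem subsingleton_extRMod_iff {x y : R} (hxy : x * y = 0) (hx : SMulExact R R x y)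
    (hy : SMulExact R R y x) (N : ModuleCat.{u} R) :
    (∀ i, 0 < i → Subsingleton (extRMod R (ModuleCat.of R (R ⧸ Ideal.span {x})) N i)) ↔
      SMulExact R N x y ∧ SMulExact R N y x := by
  have := isZero_leftDerived_succ_iff ((linearYoneda R (ModuleCat.{u} R)).obj N).rightOp hxy hx hy
  have h1 (i : ℕ) : Subsingleton (extRMod R (ModuleCat.of R (R ⧸ Ideal.span {x})) N i) ↔
     Limits.IsZero ((((linearYoneda R (ModuleCat.{u} R)).obj N).rightOp.leftDerived i).obj
      (ModuleCat.of R (R ⧸ Ideal.span {x}))) := by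
    rw [← ModuleCat.isZero_iff_subsingleton]
    exact ⟨fun h ↦ h.op, fun h ↦ h.unop⟩
  simp only [h1]
  refine this.trans ?_
  have h0 {a b : R} (hab : a * b = 0) :
    (∀ h, (ShortComplex.mk (((linearYoneda R (ModuleCat.{u} R)).obj N).rightOp.map
      (a • 𝟙 (ModuleCat.of R R))) (((linearYoneda R (ModuleCat.{u} R)).obj N).rightOp.map
      (b • 𝟙 (ModuleCat.of R R))) h).Exact) ↔ SMulExact R N b a := by
    have h2 (a : R) : ((linearYoneda R (ModuleCat.{u} R)).obj N).rightOp.map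
      (a • 𝟙 (ModuleCat.of R R)) = (a • 𝟙 _).op := by
      apply Quiver.Hom.unop_inj
      ext f : 2
      exact (Linear.smul_comp _ _ _ a _ f).trans (congrArg (a • ·) (Category.id_comp f))
    simp only [h2]
    have key (hba) := (exact_smul_id_iff (((linearYoneda R (ModuleCat.{u} R)).obj N).obj
      (Opposite.op (ModuleCat.of R R))) b a hba).trans
        (ModuleCat.homLinearEquiv (S := R) |>.trans
          (LinearMap.ringLmapEquivSelf R R N)).smulExact_iff
    have hba := smul_id_comp_smul_id
      (((linearYoneda R (ModuleCat.{u} R)).obj N).obj (Opposite.op (ModuleCat.of R R)))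
      ((mul_comm b a).trans hab)
    refine ⟨fun h ↦ ?_, fun h _ ↦ ?_⟩
    · exact (key hba).1 (h (congrArg Quiver.Hom.op hba)).unop
    · exact ((key hba).2 h).op
  rw [h0 hxy, h0 ((mul_comm _ _).trans hxy), and_comm]

end Resolution

/-- Over a local ring, an exact pair of zero-divisors on `R` stays one modulo a proper ideal `I`
as soon as the exactness conditions persist on `R ⧸ I`. -/
theorem IsEZDPair.quotient {R : Type*} [CommRing R] [IsLocalRing R] {x y : R}
    (h : IsEZDPair R R x y) (hx : x ≠ 0) (hxu : ¬ IsUnit x) {I : Ideal R} (hI : I ≠ ⊤)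
    (hxy : SMulExact R (R ⧸ I) x y) (hyx : SMulExact R (R ⧸ I) y x) :
    IsEZDPair R (R ⧸ I) x y := by
  have h0 : x * y = 0 := by simpa using (isEZDPair_iff.1 h).2.2.1 1
  have h1 (m : R ⧸ I) : x • y • m = 0 := by rw [smul_smul, h0, zero_smul]
  have not_smul_eq_one {a : R} (ha : ¬ IsUnit a) (m : R ⧸ I) : a • m ≠ 1 := by
    intro hm
    obtain ⟨b, rfl⟩ := Ideal.Quotient.mk_surjective m
    have h2 : a * b - 1 ∈ I := Ideal.Quotient.eq.1 hm
    have h3 := (IsLocalRing.mem_maximalIdeal _).2 ha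
    exact (IsLocalRing.maximalIdeal.isMaximal R).ne_top <| (Ideal.eq_top_iff_one _).2 <| by
      simpa using sub_mem (Ideal.mul_mem_right b _ h3) (IsLocalRing.le_maximalIdeal hI h2)
  refine isEZDPair_iff.2 ⟨⟨1, not_smul_eq_one hxu⟩, ⟨1, fun h2 ↦ ?_⟩, h1, hxy, hyx⟩
  · obtain ⟨m, hm⟩ := hyx 1 h2
    refine not_smul_eq_one (fun hy ↦ hx ?_) m hm
    exact hy.mul_left_eq_zero.1 h0

theorem isStrongEZDSeq_iff_smulExact {R : Type*} [CommRing R] [IsLocalRing R] {n : ℕ}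
    {x : Fin n → R} (hnz : ∀ i, x i ≠ 0) (hnu : ∀ i, ¬ IsUnit (x i))
    {V : Finset (Fin n) → Fin n → Prop}
    (hV : ∀ s j y, IsEZDPair R R (x j) y → (V s j ↔
      SMulExact R (R ⧸ Ideal.span (x '' ↑s)) (x j) y ∧
        SMulExact R (R ⧸ Ideal.span (x '' ↑s)) y (x j))) :
    IsStrongEZDSeq R x ↔ ∀ (s : Finset (Fin n)) (j : Fin n), j ∉ s →
      (∃ y : R, IsEZDPair R R (x j) y) ∧ V s j := by
  have hI (s : Set (Fin n)) : Ideal.span (x '' s) ≠ ⊤ := ne_top_of_le_ne_top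
    (IsLocalRing.maximalIdeal.isMaximal R).ne_top <| Ideal.span_le.2 <| by
      rintro _ ⟨i, -, rfl⟩
      exact (IsLocalRing.mem_maximalIdeal _).2 (hnu i)
  have e (s : Set (Fin n)) := Submodule.quotEquivOfEq (Ideal.span (x '' s) • (⊤ : Submodule R R))
    (Ideal.span (x '' s)) (Ideal.mul_top _)
  constructor
  · rintro ⟨y, -, h⟩ s j hj
    have h0 : IsEZDPair R R (x j) (y j) := (h ∅ j (by simp)).of_linearEquiv <|
      Submodule.quotEquivOfEqBot _ (by simp)
    exact ⟨⟨y j, h0⟩, (hV s j _ h0).2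
      (isEZDPair_iff.1 ((h s j hj).of_linearEquiv (e s))).2.2.2⟩
  · intro h
    choose y hy using fun j ↦ (h ∅ j (by simp)).1
    have key (s : Finset (Fin n)) (j : Fin n) (hj : j ∉ s) :
        IsEZDPair R (R ⧸ (Ideal.span (x '' ↑s) • (⊤ : Submodule R R))) (x j) (y j) := by
      have h1 := (hV s j _ (hy j)).1 (h s j hj).2
      exact ((hy j).quotient (hnz j) (hnu j) (hI _) h1.1 h1.2).of_linearEquiv (e s).symm
    refine ⟨y, fun i ↦ ?_, key⟩
    have := key (Finset.Iio i) i (by simp)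
    rwa [Finset.coe_Iio] at this

/-- For nonzero non-unit elements `x 0, …, x (n-1)` of a Noetherian local ring, TFAE:
(i) `x 0, …, x (n-1)` is a strong sequence of exact zero-divisors on `R`;
(ii) for each finset `s` of indices and `j ∉ s`, `x j` is an exact zero-divisor on `R`
and `Ext^i_R(R/(x j), R/(x i : i ∈ s)) = 0` for all `i > 0`;
(iii) for each such `s` and `j ∉ s`, `x j` is an exact zero-divisor on `R` and
`Tor^R_i(R/(x i : i ∈ s), R/(x j)) = 0` for all `i > 0`. -/
theorem isStrongEZDSeq_iff_ext_tor_vanishing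
    (R : Type u) [CommRing R] [IsNoetherianRing R] [IsLocalRing R]
    {n : ℕ} (x : Fin n → R) (hnz : ∀ i, x i ≠ 0) (hnu : ∀ i, ¬ IsUnit (x i)) :
    (IsStrongEZDSeq R x ↔
      ∀ (s : Finset (Fin n)) (j : Fin n), j ∉ s →
        (∃ y : R, IsEZDPair R R (x j) y) ∧
        ∀ i : ℕ, 0 < i →
          Subsingleton (extRMod R (ModuleCat.of R (R ⧸ Ideal.span {x j}))
            (ModuleCat.of R (R ⧸ Ideal.span (x '' ↑s))) i)) ∧
    (IsStrongEZDSeq R x ↔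
      ∀ (s : Finset (Fin n)) (j : Fin n), j ∉ s →
        (∃ y : R, IsEZDPair R R (x j) y) ∧
        ∀ i : ℕ, 0 < i →
          Subsingleton (torRMod R (ModuleCat.of R (R ⧸ Ideal.span (x '' ↑s)))
            (ModuleCat.of R (R ⧸ Ideal.span {x j})) i)) := by
  have hmul {j : Fin n} {y : R} (h : IsEZDPair R R (x j) y) : x j * y = 0 := by
    simpa using (isEZDPair_iff.1 h).2.2.1 1
  exact ⟨isStrongEZDSeq_iff_smulExact hnz hnu fun s j y h ↦
      subsingleton_extRMod_iff (hmul h) (isEZDPair_iff.1 h).2.2.2.1 (isEZDPair_iff.1 h).2.2.2.2 (ModuleCat.of R _),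
    isStrongEZDSeq_iff_smulExact hnz hnu fun s j y h ↦
      subsingleton_torRMod_iff (hmul h) (isEZDPair_iff.1 h).2.2.2.1 (isEZDPair_iff.1 h).2.2.2.2 (ModuleCat.of R _)⟩
end

section
/- Let R be a commutative Noetherian local ring and x_1, …, x_n elements of R. Then x_1, …, x_n is a strong sequence of exact zero-divisors on R if and only if it is a minimal sequence of exact zero-divisors (i.e., μ_R((x_1, …, x_n)) = n) and there exist twins y_1, …, y_n of x_1, …, x_n respectively such that x_j y_j = 0 for all j with 1 ≤ j ≤ n. -/
universe u

/-- `(x, y)` satisfies the two annihilator conditions of a pair of exact zero-divisors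
modulo the ideal `I`: `(I : x) = (y) + I` and `(I : y) = (x) + I`. -/
structure IsExactPairMod {R : Type*} [CommRing R] (I : Ideal R) (x y : R) : Prop where
  mul_mem_iff_left : ∀ a, x * a ∈ I ↔ a ∈ Ideal.span {y} ⊔ I
  mul_mem_iff_right : ∀ a, y * a ∈ I ↔ a ∈ Ideal.span {x} ⊔ I

namespace IsExactPairMod

variable {R : Type*} [CommRing R] {I : Ideal R} {x y : R}

theorem symm (h : IsExactPairMod I x y) : IsExactPairMod I y x :=
  ⟨h.2, h.1⟩

theorem mul_mem (h : IsExactPairMod I x y) : x * y ∈ I :=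
  (h.1 y).2 (Ideal.mem_sup_left (Ideal.mem_span_singleton_self y))

end IsExactPairMod

theorem mem_span_singleton_sup_of_mul_mem {R : Type*} [CommRing R] [IsNoetherianRing R]
    [IsLocalRing R] {I : Ideal R} {x y x' y' : R} (hx : x ∈ IsLocalRing.maximalIdeal R)
    (h : IsExactPairMod I x y) (h' : IsExactPairMod (Ideal.span {x} ⊔ I) x' y')
    (hxy' : x' * y' ∈ I) {a : R} (ha : x' * a ∈ I) : a ∈ Ideal.span {y'} ⊔ I := by
  let N : Ideal R := Submodule.comap (LinearMap.mulLeft R x') I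
  have hN : N ≤ Ideal.span {y'} ⊔ I := by
    refine Submodule.le_of_le_smul_of_le_jacobson_bot (I := IsLocalRing.maximalIdeal R)
      (IsNoetherian.noetherian N) (IsLocalRing.maximalIdeal_le_jacobson ⊥) ?_
    intro a ha
    replace ha : x' * a ∈ I := ha
    obtain ⟨r, b, hb, rfl⟩ :=
      Ideal.mem_span_singleton_sup.1 ((h'.1 a).1 (Ideal.mem_sup_right ha))
    obtain ⟨c, i, hi, rfl⟩ := Ideal.mem_span_singleton_sup.1 hb
    have hc : x * (x' * c) ∈ I := by
      have := I.sub_mem (I.sub_mem ha (I.mul_mem_left r hxy')) (I.mul_mem_left x' hi)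
      convert this using 1
      ring
    obtain ⟨d, i', hi', hd⟩ := Ideal.mem_span_singleton_sup.1 ((h.1 _).1 hc)
    have hyd : y * (y' * d) ∈ I := by
      have := I.sub_mem (I.mul_mem_left c hxy') (I.mul_mem_left y' hi')
      convert this using 1
      linear_combination y' * hd
    obtain ⟨e, t, ht, rfl⟩ := Ideal.mem_span_singleton_sup.1 ((h'.2 d).1 ((h.2 _).1 hyd))
    obtain ⟨f, i'', hi'', rfl⟩ := Ideal.mem_span_singleton_sup.1 ht
    have hce : c - e * y ∈ N := by
      change x' * (c - e * y) ∈ I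
      have := I.add_mem (I.add_mem (I.mul_mem_left f h.mul_mem) (I.mul_mem_left y hi'')) hi'
      convert this using 1
      linear_combination -hd
    have hsum : r * y' + (c * x + i) =
        (r * y' + (e * (x * y) + i)) + x * (c - e * y) := by ring
    rw [hsum]
    exact Submodule.add_mem_sup (Ideal.mem_span_singleton_sup.2
        ⟨r, _, I.add_mem (I.mul_mem_left e h.mul_mem) hi, rfl⟩)
      (Submodule.smul_mem_smul hx hce)
  exact hN ha

/-- Exactness of `(x', y')` descends from `R ⧸ (x)` to `R` if `x' y' = 0` (relative to `I`). -/
theorem IsExactPairMod.of_span_singleton_sup {R : Type*} [CommRing R] [IsNoetherianRing R]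
    [IsLocalRing R] {I : Ideal R} {x y x' y' : R} (hx : x ∈ IsLocalRing.maximalIdeal R)
    (h : IsExactPairMod I x y) (h' : IsExactPairMod (Ideal.span {x} ⊔ I) x' y')
    (hxy' : x' * y' ∈ I) : IsExactPairMod I x' y' := by
  have key : ∀ {u v : R}, u * v ∈ I → ∀ a, a ∈ Ideal.span {v} ⊔ I → u * a ∈ I := by
    intro u v huv a ha
    obtain ⟨r, b, hb, rfl⟩ := Ideal.mem_span_singleton_sup.1 ha
    have := I.add_mem (I.mul_mem_left r huv) (I.mul_mem_left u hb)
    convert this using 1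
    ring
  have hyx' : y' * x' ∈ I := by rwa [mul_comm]
  exact ⟨fun a => ⟨mem_span_singleton_sup_of_mul_mem hx h h' hxy', key hxy' a⟩,
    fun a => ⟨mem_span_singleton_sup_of_mul_mem hx h h'.symm hyx', key hyx' a⟩⟩

/-- If `(x, y)` is exact modulo `I` and `(x', y')` is exact modulo both `I` and `I + (x)`,
then `(x, y)` is exact modulo `I + (x')`. -/
theorem IsExactPairMod.swap {R : Type*} [CommRing R] {I : Ideal R} {x y x' y' : R}
    (h : IsExactPairMod I x y) (h' : IsExactPairMod (Ideal.span {x} ⊔ I) x' y')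
    (h'' : IsExactPairMod I x' y') : IsExactPairMod (Ideal.span {x'} ⊔ I) x y := by
  have hxy' := h''.mul_mem
  have back : ∀ {u v : R}, u * v ∈ I → ∀ a, a ∈ Ideal.span {v} ⊔ (Ideal.span {x'} ⊔ I) →
      u * a ∈ Ideal.span {x'} ⊔ I := by
    intro u v huv a ha
    obtain ⟨r, b, hb, rfl⟩ := Ideal.mem_span_singleton_sup.1 ha
    have := Ideal.add_mem _ (Ideal.mul_mem_left (Ideal.span {x'} ⊔ I) r
      (Ideal.mem_sup_right huv)) (Ideal.mul_mem_left _ u hb)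
    convert this using 1
    ring
  refine ⟨fun a => ⟨fun ha => ?_, back h.mul_mem a⟩,
    fun a => ⟨fun ha => ?_, back h.symm.mul_mem a⟩⟩
  · obtain ⟨b, i, hi, hb⟩ := Ideal.mem_span_singleton_sup.1 ha
    have hxb : x' * b ∈ Ideal.span {x} ⊔ I :=
      Ideal.mem_span_singleton_sup.2 ⟨a, -i, I.neg_mem hi, by linear_combination -hb⟩
    obtain ⟨c, t, ht, rfl⟩ := Ideal.mem_span_singleton_sup.1 ((h'.1 b).1 hxb)
    obtain ⟨d, i', hi', rfl⟩ := Ideal.mem_span_singleton_sup.1 ht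
    have had : x * (a - x' * d) ∈ I := by
      have := I.add_mem (I.add_mem (I.mul_mem_left c hxy') (I.mul_mem_left x' hi')) hi
      convert this using 1
      linear_combination -hb
    obtain ⟨g, i'', hi'', hg⟩ := Ideal.mem_span_singleton_sup.1 ((h.1 _).1 had)
    exact Ideal.mem_span_singleton_sup.2 ⟨g, d * x' + i'',
      Ideal.mem_span_singleton_sup.2 ⟨d, i'', hi'', rfl⟩, by linear_combination hg⟩
  · obtain ⟨b, i, hi, hb⟩ := Ideal.mem_span_singleton_sup.1 ha
    have hxb : x' * (x * b) ∈ I := by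
      have := I.sub_mem (I.mul_mem_left a h.mul_mem) (I.mul_mem_left x hi)
      convert this using 1
      linear_combination x * hb
    obtain ⟨c, i', hi', hc⟩ := Ideal.mem_span_singleton_sup.1 ((h''.1 (x * b)).1 hxb)
    have hyc : y' * c ∈ Ideal.span {x} ⊔ I :=
      Ideal.mem_span_singleton_sup.2 ⟨b, -i', I.neg_mem hi', by linear_combination -hc⟩
    obtain ⟨e, t, ht, rfl⟩ := Ideal.mem_span_singleton_sup.1 ((h'.2 c).1 hyc)
    obtain ⟨f, i'', hi'', rfl⟩ := Ideal.mem_span_singleton_sup.1 ht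
    have hbf : x * (b - y' * f) ∈ I := by
      have := I.add_mem (I.add_mem (I.mul_mem_left e hxy') (I.mul_mem_left y' hi'')) hi'
      convert this using 1
      linear_combination -hc
    obtain ⟨g, j, hj, hg⟩ := Ideal.mem_span_singleton_sup.1 ((h.1 _).1 hbf)
    have hag : y * (a - x' * g) ∈ I := by
      have := I.add_mem (I.add_mem (I.mul_mem_left f hxy') (I.mul_mem_left x' hj)) hi
      convert this using 1
      linear_combination -hb - x' * hg
    obtain ⟨r, k, hk, hr⟩ := Ideal.mem_span_singleton_sup.1 ((h.2 _).1 hag)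
    exact Ideal.mem_span_singleton_sup.2 ⟨r, g * x' + k,
      Ideal.mem_span_singleton_sup.2 ⟨g, k, hk, rfl⟩, by linear_combination hr⟩

theorem isExactPairMod_span_image {R : Type*} [CommRing R] [IsNoetherianRing R] [IsLocalRing R]
    {n : ℕ} {x y : Fin n → R} (hx : ∀ i, x i ∈ IsLocalRing.maximalIdeal R)
    (hxy : ∀ i, x i * y i = 0)
    (h : ∀ i, IsExactPairMod (Ideal.span (x '' {j | j < i})) (x i) (y i))
    (s : Finset (Fin n)) (j : Fin n) (hj : j ∉ s) :
    IsExactPairMod (Ideal.span (x '' ↑s)) (x j) (y j) := by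
  have hins : ∀ (s : Finset (Fin n)) (i : Fin n),
      Ideal.span (x '' ↑(insert i s)) = Ideal.span {x i} ⊔ Ideal.span (x '' ↑s) := by
    intro s i
    rw [Finset.coe_insert, Set.image_insert_eq, Ideal.span_insert]
  have hzero : ∀ (I : Ideal R) (i : Fin n), x i * y i ∈ I := fun I i => by
    rw [hxy i]
    exact I.zero_mem
  suffices H : ∀ (k : ℕ) (s : Finset (Fin n)) (j : Fin n), j ∉ s → (∀ i ∈ s, (i : ℕ) < k) →
      (j : ℕ) < k → IsExactPairMod (Ideal.span (x '' ↑s)) (x j) (y j) from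
    H n s j hj (fun i _ => i.2) j.2
  clear s j hj
  intro k
  induction k with
  | zero => intro s j _ _ hj; omega
  | succ k ih =>
    -- the pair with index `k` is exact modulo any subset of the earlier elements
    have top : ∀ (j : Fin n), (j : ℕ) = k → ∀ t : Finset (Fin n), ∀ s : Finset (Fin n),
        s ∪ t = Finset.Iio j → IsExactPairMod (Ideal.span (x '' ↑s)) (x j) (y j) := by
      intro j hj t
      induction t using Finset.induction_on with
      | empty =>
        intro s hs
        rw [Finset.union_empty] at hs
        subst hs
        simpa [Set.Iio] using h j
      | insert i t _ iht =>
        intro s hs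
        have hs' : insert i s ∪ t = Finset.Iio j := by
          rw [← hs, Finset.insert_union, Finset.union_insert]
        by_cases his : i ∈ s
        · rw [Finset.insert_eq_of_mem his] at hs'
          exact iht s hs'
        have hlt : ∀ l ∈ insert i s, (l : ℕ) < k := fun l hl => by
          have : l ∈ Finset.Iio j := hs' ▸ Finset.mem_union_left _ hl
          rw [Finset.mem_Iio] at this
          omega
        have h1 := ih s i his (fun l hl => hlt l (Finset.mem_insert_of_mem hl))
          (hlt i (Finset.mem_insert_self _ _))
        have h2 := iht _ hs'
        rw [hins] at h2
        exact .of_span_singleton_sup (hx i) h1 h2 (hzero _ j)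
    have top' : ∀ (j : Fin n), (j : ℕ) = k → ∀ s : Finset (Fin n), (∀ i ∈ s, (i : ℕ) < k) →
        IsExactPairMod (Ideal.span (x '' ↑s)) (x j) (y j) := fun j hj s hs =>
      top j hj (Finset.Iio j) s (Finset.union_eq_right.2 fun i hi => by
        have := hs i hi
        rw [Finset.mem_Iio]
        omega)
    intro s j hjs hs hj
    by_cases hjk : (j : ℕ) = k
    · refine top' j hjk s fun i hi => ?_
      have := hs i hi
      have : i ≠ j := fun e => hjs (e ▸ hi)
      omega
    · by_cases hex : ∃ l ∈ s, (l : ℕ) = k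
      · obtain ⟨l, hl, hlk⟩ := hex
        have hlt : ∀ i ∈ s.erase l, (i : ℕ) < k := fun i hi => by
          have := hs i (Finset.mem_of_mem_erase hi)
          have := Finset.ne_of_mem_erase hi
          omega
        have h1 := ih (s.erase l) j (fun hm => hjs (Finset.mem_of_mem_erase hm)) hlt (by omega)
        have h2 := top' l hlk (insert j (s.erase l)) fun i hi => by
          rcases Finset.mem_insert.1 hi with rfl | hi
          · omega
          · exact hlt i hi
        rw [hins] at h2
        have h3 := h1.swap h2 (top' l hlk _ hlt)
        rwa [← hins, Finset.insert_erase hl] at h3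
      · refine ih s j hjs (fun i hi => ?_) (by omega)
        have := hs i hi
        have : (i : ℕ) ≠ k := fun e => hex ⟨i, hi, e⟩
        omega

theorem isEZDPair_quotient_smul_top_iff {R : Type*} [CommRing R] (I : Ideal R) (x y : R) :
    IsEZDPair R (R ⧸ (I • (⊤ : Submodule R R))) x y ↔
      Ideal.span {x} ⊔ I ≠ ⊤ ∧ x ∉ I ∧ IsExactPairMod I x y := by
  obtain ⟨J, hJ⟩ : ∃ J : Submodule R R, J = I • (⊤ : Submodule R R) := ⟨_, rfl⟩
  have hJI : J = I := by rw [hJ, smul_eq_mul, Ideal.mul_top]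
  rw [← hJ]
  subst hJI
  clear hJ
  have hmem : ∀ r a : R, (Submodule.Quotient.mk a : R ⧸ J) ∈
      Ideal.span {r} • (⊤ : Submodule R (R ⧸ J)) ↔ a ∈ Ideal.span {r} ⊔ J := by
    intro r a
    rw [Submodule.ideal_span_singleton_smul, Submodule.mem_smul_pointwise_iff_exists,
      Ideal.mem_span_singleton_sup]
    constructor
    · rintro ⟨m, -, hm⟩
      obtain ⟨b, rfl⟩ := Submodule.Quotient.mk_surjective J m
      rw [← Submodule.Quotient.mk_smul, eq_comm, Submodule.Quotient.eq] at hm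
      exact ⟨b, _, hm, by rw [smul_eq_mul]; ring⟩
    · rintro ⟨b, i, hi, rfl⟩
      refine ⟨Submodule.Quotient.mk b, trivial, ?_⟩
      rw [← Submodule.Quotient.mk_smul, eq_comm, Submodule.Quotient.eq]
      convert hi using 1
      rw [smul_eq_mul]
      ring
  have htor : ∀ r a : R, (Submodule.Quotient.mk a : R ⧸ J) ∈
      Submodule.torsionBy R (R ⧸ J) r ↔ r * a ∈ J := by
    intro r a
    rw [Submodule.mem_torsionBy_iff, ← Submodule.Quotient.mk_smul,
      Submodule.Quotient.mk_eq_zero, smul_eq_mul]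
  have heq : ∀ r r' : R, Submodule.torsionBy R (R ⧸ J) r =
      Ideal.span {r'} • (⊤ : Submodule R (R ⧸ J)) ↔
        ∀ a, r * a ∈ J ↔ a ∈ Ideal.span {r'} ⊔ J := by
    intro r r'
    rw [SetLike.ext_iff, (Submodule.Quotient.mk_surjective J).forall]
    simp only [hmem, htor]
  have htop : Ideal.span {x} • (⊤ : Submodule R (R ⧸ J)) = ⊤ ↔ Ideal.span {x} ⊔ J = ⊤ := by
    rw [Submodule.eq_top_iff', (Submodule.Quotient.mk_surjective J).forall,
      Submodule.eq_top_iff']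
    simp only [hmem]
  have hne : (∃ m : R ⧸ J, x • m ≠ 0) ↔ x ∉ J := by
    rw [(Submodule.Quotient.mk_surjective J).exists]
    simp only [← Submodule.Quotient.mk_smul, ne_eq, Submodule.Quotient.mk_eq_zero, smul_eq_mul]
    exact ⟨fun ⟨a, ha⟩ hx => ha (Ideal.mul_mem_right a J hx), fun hx => ⟨1, by rwa [mul_one]⟩⟩
  rw [IsEZDPair, ne_eq, htop, hne, heq, heq]
  exact ⟨fun ⟨h1, h2, h3, h4⟩ => ⟨h1, h2, h3, h4⟩, fun ⟨h1, h2, h3, h4⟩ => ⟨h1, h2, h3, h4⟩⟩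

theorem minGens_le_card {R : Type*} [CommRing R] (s : Finset R) :
    minGens R (Ideal.span (s : Set R)) ≤ s.card :=
  Nat.sInf_le ⟨s, rfl, rfl⟩

theorem notMem_span_image_of_minGens_eq {R : Type*} [CommRing R] {n : ℕ} {x : Fin n → R}
    (hmin : minGens R (Ideal.span (Set.range x)) = n) {s : Finset (Fin n)} {j : Fin n}
    (hj : j ∉ s) : x j ∉ Ideal.span (x '' ↑s) := by
  classical
  intro hx
  have hspan : Ideal.span (Set.range x) =
      Ideal.span (((Finset.univ.erase j).image x : Finset R) : Set R) := by
    rw [Finset.coe_image]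
    refine le_antisymm (Ideal.span_le.2 ?_) (Ideal.span_mono (Set.image_subset_range _ _))
    rintro _ ⟨i, rfl⟩
    by_cases hij : i = j
    · subst hij
      refine Ideal.span_mono (Set.image_mono fun l hl => ?_) hx
      have : l ≠ i := fun e => hj (e ▸ hl)
      simpa using this
    · exact Ideal.subset_span ⟨i, by simpa using hij, rfl⟩
  have hle := minGens_le_card ((Finset.univ.erase j).image x)
  rw [← hspan, hmin] at hle
  have hcard := hle.trans Finset.card_image_le
  rw [Finset.card_erase_of_mem (Finset.mem_univ j), Finset.card_univ, Fintype.card_fin] at hcard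
  have := j.2
  omega

theorem minGens_span_range_eq_of_notMem {R : Type*} [CommRing R] [IsLocalRing R]
    {n : ℕ} (x : Fin n → R)
    (hx : ∀ j, x j ∉ Ideal.span (x '' ↑(Finset.univ.erase j))) :
    minGens R (Ideal.span (Set.range x)) = n := by
  classical
  have hrange : Ideal.span ((Finset.univ.image x : Finset R) : Set R) =
      Ideal.span (Set.range x) := by
    rw [Finset.coe_image, Finset.coe_univ, Set.image_univ]
  refine le_antisymm ?_ (le_csInf ⟨_, _, rfl, hrange⟩ ?_)
  · have h := minGens_le_card (Finset.univ.image x)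
    rw [hrange] at h
    exact h.trans (Finset.card_image_le.trans (by simp))
  rintro k ⟨s, rfl, hs⟩
  by_contra! hlt
  have hxs : ∀ i, ∃ c : R → R, ∑ a ∈ s, c a * a = x i := by
    intro i
    have : x i ∈ Ideal.span (s : Set R) := hs ▸ Ideal.subset_span ⟨i, rfl⟩
    obtain ⟨c, -, hc⟩ := Submodule.mem_span_finset.1 this
    exact ⟨c, hc⟩
  choose A hA using hxs
  have hdep : ¬ LinearIndependent (IsLocalRing.ResidueField R)
      (fun (i : Fin n) (a : s) => IsLocalRing.residue R (A i a)) := fun hli => by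
    have := hli.fintype_card_le_finrank
    simp at this
    omega
  rw [Fintype.not_linearIndependent_iff] at hdep
  obtain ⟨g, hg, j, hj⟩ := hdep
  choose c hc using fun i => IsLocalRing.residue_surjective (g i)
  set I := Ideal.span (Set.range x) with hI
  have hrel : ∑ i, c i * x i ∈ IsLocalRing.maximalIdeal R • I := by
    have : ∑ i, c i * x i = ∑ a ∈ s, (∑ i, c i * A i a) • a := by
      simp_rw [← hA, Finset.mul_sum, smul_eq_mul, Finset.sum_mul]
      rw [Finset.sum_comm]
      simp_rw [mul_assoc]
    rw [this]
    refine Submodule.sum_mem _ fun a ha => Submodule.smul_mem_smul ?_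
      (hs ▸ Ideal.subset_span ha)
    have := congrFun hg ⟨a, ha⟩
    rw [← IsLocalRing.residue_eq_zero_iff, map_sum]
    simpa [hc] using this
  have hunit : IsUnit (c j) := by
    rw [← IsLocalRing.notMem_maximalIdeal, ← IsLocalRing.residue_eq_zero_iff, hc]
    exact hj
  refine hx j ?_
  have hle : I ≤ Ideal.span (x '' ↑(Finset.univ.erase j)) := by
    refine Submodule.le_of_le_smul_of_le_jacobson_bot (I := IsLocalRing.maximalIdeal R)
      ⟨_, hrange⟩ (IsLocalRing.maximalIdeal_le_jacobson ⊥) (Ideal.span_le.2 ?_)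
    have hothers : ∀ i ≠ j, x i ∈ Ideal.span (x '' ↑(Finset.univ.erase j)) := fun i hi =>
      Ideal.subset_span ⟨i, by simpa using hi, rfl⟩
    rintro _ ⟨i, rfl⟩
    by_cases hij : i = j
    · subst hij
      refine ((Ideal.span (x '' ↑(Finset.univ.erase i)) ⊔
        IsLocalRing.maximalIdeal R • I).unit_mul_mem_iff_mem hunit).1 ?_
      rw [← Finset.add_sum_erase _ _ (Finset.mem_univ i)] at hrel
      rw [← add_sub_cancel_right (c i * x i) (∑ l ∈ Finset.univ.erase i, c l * x l)]
      exact Ideal.sub_mem _ (Ideal.mem_sup_right hrel) (Ideal.mem_sup_left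
        (Ideal.sum_mem _ fun l hl =>
          Ideal.mul_mem_left _ _ (hothers l (Finset.ne_of_mem_erase hl))))
    · exact Ideal.mem_sup_left (hothers i hij)
  exact hle (Ideal.subset_span ⟨j, rfl⟩)

/-- Elements `x 0, …, x (n-1)` of a Noetherian local ring form a strong sequence of
exact zero-divisors iff they form a minimal sequence of exact zero-divisors
(`μ_R((x 0, …, x (n-1))) = n`) admitting twins `y 0, …, y (n-1)` with
`x j * y j = 0` for all `j`. -/
theorem isStrongEZDSeq_iff_minimal_and_twins_mul_zero
    (R : Type u) [CommRing R] [IsNoetherianRing R] [IsLocalRing R]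
    {n : ℕ} (x : Fin n → R) :
    IsStrongEZDSeq R x ↔
      (IsEZDSeq R R x ∧ minGens R (Ideal.span (Set.range x)) = n ∧
        ∃ y : Fin n → R, IsEZDSeqWithTwins R R x y ∧ ∀ j : Fin n, x j * y j = 0) := by
  constructor
  · rintro ⟨y, hseq, hstrong⟩
    refine ⟨fun i => ⟨y i, hseq i⟩, ?_, y, hseq, fun j => ?_⟩
    · refine minGens_span_range_eq_of_notMem x fun j => ?_
      have h := hstrong (Finset.univ.erase j) j (Finset.notMem_erase j _)
      exact ((isEZDPair_quotient_smul_top_iff _ _ _).1 h).2.1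
    · have h := ((isEZDPair_quotient_smul_top_iff _ _ _).1
        (hstrong ∅ j (Finset.notMem_empty j))).2.2.mul_mem
      simpa using h
  · rintro ⟨-, hmin, y, hseq, hxy⟩
    have hpair := fun i => (isEZDPair_quotient_smul_top_iff _ _ _).1 (hseq i)
    have hmem : ∀ i, x i ∈ IsLocalRing.maximalIdeal R := fun i =>
      IsLocalRing.le_maximalIdeal (hpair i).1
        (Ideal.mem_sup_left (Ideal.mem_span_singleton_self (x i)))
    refine ⟨y, hseq, fun s j hj => ?_⟩
    rw [isEZDPair_quotient_smul_top_iff]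
    refine ⟨fun htop => ?_, notMem_span_image_of_minGens_eq hmin hj, ?_⟩
    · refine (IsLocalRing.maximalIdeal.isMaximal R).ne_top (top_le_iff.1 (htop ▸ ?_))
      refine sup_le ((Ideal.span_singleton_le_iff_mem _).2 (hmem j)) (Ideal.span_le.2 ?_)
      rintro _ ⟨i, -, rfl⟩
      exact hmem i
    · exact isExactPairMod_span_image hmem hxy (fun i => (hpair i).2.2) s j hj
end
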